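/- Let P ⊂ ℝ⁵ be a 5-dimensional real reflexive polytope (i.e. reflexive and every complex root of L_P has imaginary part 0). Then vol(P) ≥ 16/5. -/

import Mathlib

open Pointwise MeasureTheory Polynomial

noncomputable section

/-- The lattice points of a subset `S ⊆ ℝ^d`: integer vectors whose real cast lies in `S`. -/
def latticePts (d : ℕ) (S : Set (Fin d → ℝ)) : Set (Fin d → ℤ) :=
  {x | (fun i => (x i : ℝ)) ∈ S}

/-- `P ⊆ ℝ^d` is a lattice polytope: the convex hull of finitely many integer points. -/
def IsLatticePolytope (d : ℕ) (P : Set (Fin d → ℝ)) : Prop :=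
  ∃ V : Finset (Fin d → ℤ),
    P = convexHull ℝ ((fun v : Fin d → ℤ => fun i => (v i : ℝ)) '' (V : Set (Fin d → ℤ)))

/-- `P` is full-dimensional in `ℝ^d`. -/
def IsFullDim (d : ℕ) (P : Set (Fin d → ℝ)) : Prop :=
  affineSpan ℝ P = ⊤

/-- `L` is the Ehrhart polynomial of `P`: `L(m) = |mP ∩ ℤ^d|` for every natural number `m`. -/
def IsEhrhart (d : ℕ) (P : Set (Fin d → ℝ)) (L : Polynomial ℚ) : Prop :=
  ∀ m : ℕ, L.eval (m : ℚ) = ((latticePts d ((m : ℝ) • P)).ncard : ℚ)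

/-- The complex roots of a rational polynomial, counted with multiplicity. -/
def cRoots (L : Polynomial ℚ) : Multiset ℂ :=
  (L.map (algebraMap ℚ ℂ)).roots

/-- `L` is a CL-polynomial: every complex root has real part `-1/2`. -/
def IsCL (L : Polynomial ℚ) : Prop :=
  ∀ z ∈ cRoots L, z.re = -(1/2 : ℝ)

/-- `L` has only real roots: every complex root has imaginary part `0`. -/
def IsRealRooted (L : Polynomial ℚ) : Prop :=
  ∀ z ∈ cRoots L, z.im = 0

/-- The dual (polar) body `{u : ⟨u,v⟩ ≥ -1 for all v ∈ P}`. -/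
def dualBody (d : ℕ) (P : Set (Fin d → ℝ)) : Set (Fin d → ℝ) :=
  {u | ∀ v ∈ P, -1 ≤ ∑ i, u i * v i}

/-- `P` is reflexive: the origin is interior and the dual body is a lattice polytope. -/
def IsReflexive (d : ℕ) (P : Set (Fin d → ℝ)) : Prop :=
  (0 : Fin d → ℝ) ∈ interior P ∧ IsLatticePolytope d (dualBody d P)

/-- The Euclidean volume of `P ⊆ ℝ^d`. -/
def vol (d : ℕ) (P : Set (Fin d → ℝ)) : ℝ :=
  (volume P).toReal

/-- `δ` is the δ-vector of the Ehrhart polynomial `L` in dimension `d`: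
`L(m) = ∑_{j=0}^d δ_j C(d+m-j, d)` for all natural numbers `m`. -/
def HasDeltaVector (d : ℕ) (L : Polynomial ℚ) (δ : Fin (d+1) → ℤ) : Prop :=
  ∀ m : ℕ, L.eval (m : ℚ) = ∑ j : Fin (d+1), (δ j : ℚ) * (Nat.choose (d + m - (j : ℕ)) d : ℚ)

/-- The discriminant `B²C² − 4AC³ − 4B³D − 27A²D² + 18ABCD` of the cubic `Az³+Bz²+Cz+D`. -/
def cubicDisc (A B C D : ℚ) : ℚ :=
  B^2*C^2 - 4*A*C^3 - 4*B^3*D - 27*A^2*D^2 + 18*A*B*C*D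

section HalfOpenCones

variable {E ι : Type*} [AddCommGroup E] [Module ℝ E] [Fintype ι]

/-- Linear coordinates on `E` with respect to a basis `(v i)_{i ∈ B}` extracted from a finite family
`v`; coordinates outside `B` are zero. -/
structure ConeCoords (v : ι → E) (B : Finset ι) where
  /-- The coordinate map. -/
  coord : E →ₗ[ℝ] (ι → ℝ)
  coord_of_notMem : ∀ x, ∀ i ∉ B, coord x i = 0
  sum_coord_smul : ∀ x, ∑ i, coord x i • v i = x
  coord_sum : ∀ c : ι → ℝ, (∀ i ∉ B, c i = 0) → coord (∑ i, c i • v i) = c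

/-- Elements of the subgroup `Λ` lying in `S` at height `k` with respect to `ℓ`. -/
def latticeSlice (Λ : AddSubgroup E) (ℓ : E →ₗ[ℝ] ℝ) (S : Set E) (k : ℕ) : Set E :=
  {x | x ∈ Λ ∧ ℓ x = k ∧ x ∈ S}

/-- The simplicial cone on `B` with the facet opposite to `i` kept exactly when `s i`. -/
def ConeCoords.halfOpenCone {v : ι → E} {B : Finset ι} (β : ConeCoords v B) (s : ι → Prop) :
    Set E :=
  {x | ∀ i ∈ B, 0 < β.coord x i ∨ (s i ∧ β.coord x i = 0)}

/-- The fundamental parallelepiped of the half-open simplicial cone `halfOpenCone β s`. -/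
def ConeCoords.halfOpenBox {v : ι → E} {B : Finset ι} (β : ConeCoords v B) (s : ι → Prop) :
    Set E :=
  {x | ∀ i ∈ B, (0 < β.coord x i ∧ β.coord x i < 1) ∨ (s i ∧ β.coord x i = 0) ∨
    (¬ s i ∧ β.coord x i = 1)}

open Classical in
/-- The integer part of `t` whose remainder lies in `[0, 1)` if `s` holds, in `(0, 1]` otherwise. -/
def halfOpenFloor (s : Prop) (t : ℝ) : ℤ :=
  if s then ⌊t⌋ else ⌈t⌉ - 1

lemma halfOpenFloor_nonneg {s : Prop} {t : ℝ} (h : 0 < t ∨ (s ∧ t = 0)) :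
    0 ≤ halfOpenFloor s t := by
  unfold halfOpenFloor
  split_ifs with hs
  · rcases h with h | h
    · exact Int.floor_nonneg.2 h.le
    · simp [h.2]
  · have : 0 < t := by tauto
    have := Int.ceil_pos.2 this
    omega

lemma sub_halfOpenFloor_mem (s : Prop) (t : ℝ) :
    (0 < t - halfOpenFloor s t ∧ t - halfOpenFloor s t < 1) ∨ (s ∧ t - halfOpenFloor s t = 0) ∨
      (¬ s ∧ t - halfOpenFloor s t = 1) := by
  unfold halfOpenFloor
  split_ifs with hs
  · have h1 := Int.floor_le t
    have h2 := Int.lt_floor_add_one t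
    rcases h1.lt_or_eq with h | h
    · left; constructor <;> linarith
    · right; left; exact ⟨hs, by linarith⟩
  · have h1 := Int.le_ceil t
    have h2 := Int.ceil_lt_add_one t
    push_cast
    rcases h1.lt_or_eq with h | h
    · left; constructor <;> linarith
    · right; right; exact ⟨hs, by linarith⟩

lemma halfOpenFloor_add_natCast {s : Prop} {t : ℝ}
    (h : (0 < t ∧ t < 1) ∨ (s ∧ t = 0) ∨ (¬ s ∧ t = 1)) (k : ℕ) :
    halfOpenFloor s (t + k) = k := by
  unfold halfOpenFloor
  split_ifs with hs
  · rw [Int.floor_eq_iff]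
    push_cast
    constructor <;> rcases h with h | h | h <;> first | linarith [h.1, h.2] | linarith [h.2] | tauto
  · have : ⌈t + (k : ℝ)⌉ = (k : ℤ) + 1 := by
      rw [Int.ceil_eq_iff]
      push_cast
      constructor <;> rcases h with h | h | h <;>
        first | linarith [h.1, h.2] | linarith [h.2] | tauto
    omega

lemma card_piAntidiag_nat [DecidableEq ι] (B : Finset ι) (k : ℕ) :
    (B.piAntidiag k).card = B.card.multichoose k := by
  rw [← Finset.card_finsuppAntidiag_nat_eq_multichoose]
  refine Finset.card_bij' (fun f _ => Finsupp.equivFunOnFinite.symm f) (fun f _ => f) ?_ ?_ ?_ ?_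
  · intro f hf
    simp only [Finset.mem_piAntidiag] at hf
    simp only [Finset.mem_finsuppAntidiag]
    refine ⟨by simpa using hf.1, fun i hi => hf.2 i (by simpa using hi)⟩
  · intro f hf
    simp only [Finset.mem_finsuppAntidiag] at hf
    simp only [Finset.mem_piAntidiag]
    exact ⟨hf.1, fun i hi => hf.2 (by simpa using hi)⟩
  · intro f _; rfl
  · intro f _; ext; rfl

namespace ConeCoords

variable {v : ι → E} {B : Finset ι} (β : ConeCoords v B)

lemma apply_eq_sum_coord {ℓ : E →ₗ[ℝ] ℝ} (hℓ : ∀ i, ℓ (v i) = 1) (x : E) :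
    ℓ x = ∑ i ∈ B, β.coord x i := by
  conv_lhs => rw [← β.sum_coord_smul x]
  rw [map_sum]
  simp only [map_smul, hℓ, smul_eq_mul, mul_one]
  exact (Finset.sum_subset (Finset.subset_univ B)
    (fun i _ hi => β.coord_of_notMem x i hi)).symm

lemma halfOpenBox_subset (s : ι → Prop) : β.halfOpenBox s ⊆ β.halfOpenCone s := by
  intro x hx i hi
  rcases hx i hi with h | h | h
  · exact Or.inl h.1
  · exact Or.inr h
  · left; rw [h.2]; exact one_pos

theorem ncard_latticeSlice_halfOpenCone {Λ : AddSubgroup E} {ℓ : E →ₗ[ℝ] ℝ}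
    (hv : ∀ i, v i ∈ Λ) (hℓ : ∀ i, ℓ (v i) = 1) (hlevel : ∀ x ∈ Λ, ∃ k : ℤ, ℓ x = k)
    (s : ι → Prop) (hfin : ∀ k, (latticeSlice Λ ℓ (β.halfOpenCone s) k).Finite) (m : ℕ) :
    (latticeSlice Λ ℓ (β.halfOpenCone s) m).ncard =
      ∑ jk ∈ Finset.HasAntidiagonal.antidiagonal m,
        (latticeSlice Λ ℓ (β.halfOpenBox s) jk.1).ncard * B.card.multichoose jk.2 := by
  classical
  have hfin' : ∀ k, (latticeSlice Λ ℓ (β.halfOpenBox s) k).Finite := fun k =>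
    (hfin k).subset fun x hx => ⟨hx.1, hx.2.1, β.halfOpenBox_subset s hx.2.2⟩
  have hcard : ∀ k, (latticeSlice Λ ℓ (β.halfOpenBox s) k).ncard = (hfin' k).toFinset.card :=
    fun k => Set.ncard_eq_toFinset_card _ (hfin' k)
  have hreg : ∀ c : ι → ℕ, (∀ i, c i ≠ 0 → i ∈ B) → ∀ y,
      β.coord (y + ∑ i, (c i : ℝ) • v i) = fun i => β.coord y i + c i := by
    intro c hc y
    rw [map_add, β.coord_sum (fun i => (c i : ℝ))]
    · rfl
    · intro i hi
      by_contra h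
      exact hi (hc i (by simpa using h))
  have hmem : ∀ c : ι → ℕ, ∑ i, (c i : ℝ) • v i ∈ Λ := fun c =>
    Λ.sum_mem fun i _ => by
      rw [Nat.cast_smul_eq_nsmul]
      exact Λ.nsmul_mem (hv i) _
  have hheight : ∀ c : ι → ℕ, ℓ (∑ i, (c i : ℝ) • v i) = ∑ i, (c i : ℝ) := by
    intro c
    simp [map_sum, hℓ]
  have hsumB : ∀ c : ι → ℕ, (∀ i, c i ≠ 0 → i ∈ B) → ∑ i, c i = ∑ i ∈ B, c i := by
    intro c hc
    refine (Finset.sum_subset (Finset.subset_univ B) fun i _ hi => ?_).symm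
    by_contra h
    exact hi (hc i h)
  simp_rw [hcard, ← card_piAntidiag_nat, ← Finset.card_product]
  rw [Set.ncard_eq_toFinset_card _ (hfin m), ← Finset.card_sigma]
  symm
  let cf : E → ι → ℕ := fun x i => if i ∈ B then (halfOpenFloor (s i) (β.coord x i)).toNat else 0
  have hcf0 : ∀ x i, cf x i ≠ 0 → i ∈ B := by
    intro x i h
    by_contra hi
    exact h (by simp [cf, hi])
  have hcf : ∀ x ∈ β.halfOpenCone s, ∀ i ∈ B,
      ((cf x i : ℕ) : ℝ) = (halfOpenFloor (s i) (β.coord x i) : ℝ) := by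
    intro x hx i hi
    have := Int.toNat_of_nonneg (halfOpenFloor_nonneg (hx i hi))
    simp only [cf, hi, if_true]
    exact_mod_cast this
  refine Finset.card_bij (fun z _ => z.2.1 + ∑ i, (z.2.2 i : ℝ) • v i) ?_ ?_ ?_
  · rintro ⟨⟨j, k⟩, y, c⟩ h
    simp only [Finset.mem_sigma, Finset.HasAntidiagonal.mem_antidiagonal, Finset.mem_product,
      Set.Finite.mem_toFinset, Finset.mem_piAntidiag] at h ⊢
    obtain ⟨hjk, ⟨hy1, hy2, hy3⟩, hc1, hc2⟩ := h
    refine ⟨Λ.add_mem hy1 (hmem c), ?_, ?_⟩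
    · rw [map_add, hheight, hy2, ← hjk, ← hc1, ← hsumB c hc2]
      push_cast; rfl
    · intro i hi
      rw [hreg c hc2]
      have h0 : (0 : ℝ) ≤ c i := Nat.cast_nonneg _
      rcases β.halfOpenBox_subset s hy3 i hi with h | h
      · left; dsimp only; linarith
      · rcases h0.lt_or_eq with h' | h'
        · left; dsimp only; linarith
        · right; refine ⟨h.1, ?_⟩; dsimp only; linarith
  · rintro ⟨⟨j, k⟩, y, c⟩ h ⟨⟨j', k'⟩, y', c'⟩ h' heq
    simp only [Finset.mem_sigma, Finset.HasAntidiagonal.mem_antidiagonal, Finset.mem_product,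
      Set.Finite.mem_toFinset, Finset.mem_piAntidiag] at h h' heq
    obtain ⟨hjk, ⟨hy1, hy2, hy3⟩, hc1, hc2⟩ := h
    obtain ⟨hjk', ⟨hy1', hy2', hy3'⟩, hc1', hc2'⟩ := h'
    have hcc : c = c' := by
      funext i
      by_cases hi : i ∈ B
      · have e1 := halfOpenFloor_add_natCast (hy3 i hi) (c i)
        have e2 := halfOpenFloor_add_natCast (hy3' i hi) (c' i)
        have e3 := congrFun (congrArg β.coord heq) i
        rw [hreg c hc2, hreg c' hc2'] at e3
        dsimp only at e3
        rw [e3, e2] at e1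
        exact_mod_cast e1.symm
      · have := mt (hc2 i) hi
        have := mt (hc2' i) hi
        omega
    subst hcc
    have hyy : y = y' := by simpa using heq
    subst hyy
    have hkk : k = k' := by omega
    have hjj : j = j' := by
      have := hy2.symm.trans hy2'
      exact_mod_cast this
    subst hkk hjj
    rfl
  · intro x hx
    simp only [Set.Finite.mem_toFinset] at hx
    obtain ⟨hx1, hx2, hx3⟩ := hx
    set c := cf x with hc
    set y := x - ∑ i, (c i : ℝ) • v i with hy
    have hxy : x = y + ∑ i, (c i : ℝ) • v i := by simp [hy]
    have hyΛ : y ∈ Λ := Λ.sub_mem hx1 (hmem c)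
    have hcoord : ∀ i, β.coord y i = β.coord x i - c i := by
      intro i
      have := congrFun (hreg c (hcf0 x) y) i
      rw [← hxy] at this
      linarith
    have hybox : y ∈ β.halfOpenBox s := by
      intro i hi
      rw [hcoord i, hcf x hx3 i hi]
      exact sub_halfOpenFloor_mem _ _
    have hy0 : 0 ≤ ℓ y := by
      rw [β.apply_eq_sum_coord hℓ]
      refine Finset.sum_nonneg fun i hi => ?_
      rcases β.halfOpenBox_subset s hybox i hi with h | h
      · exact h.le
      · exact h.2.ge
    obtain ⟨j, hj⟩ := hlevel y hyΛ
    have hj0 : 0 ≤ j := by rw [hj] at hy0; exact_mod_cast hy0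
    lift j to ℕ using hj0
    have hsum : ℓ x = ℓ y + ∑ i, (c i : ℝ) := by
      conv_lhs => rw [hxy, map_add, hheight]
    refine ⟨⟨⟨j, ∑ i, c i⟩, y, c⟩, ?_, hxy.symm⟩
    simp only [Finset.mem_sigma, Finset.HasAntidiagonal.mem_antidiagonal, Finset.mem_product,
      Set.Finite.mem_toFinset, Finset.mem_piAntidiag]
    refine ⟨?_, ⟨hyΛ, by simpa using hj, hybox⟩, (hsumB c (hcf0 x)).symm, hcf0 x⟩
    rw [hx2, hj] at hsum
    exact_mod_cast hsum.symm

lemma latticeSlice_halfOpenBox_eq_empty {Λ : AddSubgroup E} {ℓ : E →ₗ[ℝ] ℝ}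
    (hℓ : ∀ i, ℓ (v i) = 1) (s : ι → Prop) {j : ℕ} (hj : B.card < j) :
    latticeSlice Λ ℓ (β.halfOpenBox s) j = ∅ := by
  rw [Set.eq_empty_iff_forall_notMem]
  rintro x ⟨-, hx, hbox⟩
  rw [β.apply_eq_sum_coord hℓ] at hx
  have : ∑ i ∈ B, β.coord x i ≤ ∑ i ∈ B, (1 : ℝ) := by
    refine Finset.sum_le_sum fun i hi => ?_
    rcases hbox i hi with h | h | h <;> linarith [h.2]
  rw [hx] at this
  simp only [Finset.sum_const, nsmul_eq_mul, mul_one, Nat.cast_le] at this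
  omega

/-- Reflecting the half-open parallelepiped through its centre exchanges kept and removed facets. -/
lemma ncard_latticeSlice_halfOpenBox_not {Λ : AddSubgroup E} {ℓ : E →ₗ[ℝ] ℝ}
    (hv : ∀ i, v i ∈ Λ) (hℓ : ∀ i, ℓ (v i) = 1) (s : ι → Prop) {j k : ℕ} (hjk : j + k = B.card) :
    (latticeSlice Λ ℓ (β.halfOpenBox fun i => ¬ s i) j).ncard =
      (latticeSlice Λ ℓ (β.halfOpenBox s) k).ncard := by
  classical
  set e : E := ∑ i ∈ B, v i with he
  have heΛ : e ∈ Λ := Λ.sum_mem fun i _ => hv i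
  have hℓe : ℓ e = B.card := by simp [he, hℓ]
  have hcoord : ∀ i ∈ B, β.coord e i = 1 := by
    intro i hi
    have h1 : e = ∑ i, (if i ∈ B then (1 : ℝ) else 0) • v i := by
      simp [he, Finset.sum_ite_mem]
    rw [h1, β.coord_sum _ (fun i hi => by simp [hi])]
    simp [hi]
  have hjk' : (j : ℝ) + k = B.card := by exact_mod_cast hjk
  have key : latticeSlice Λ ℓ (β.halfOpenBox fun i => ¬ s i) j =
      (fun x => e - x) '' latticeSlice Λ ℓ (β.halfOpenBox s) k := by
    ext x
    constructor
    · rintro ⟨h1, h2, h3⟩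
      refine ⟨e - x, ⟨Λ.sub_mem heΛ h1, by rw [map_sub, hℓe, h2]; linarith, ?_⟩, by simp⟩
      intro i hi
      rw [map_sub, Pi.sub_apply, hcoord i hi]
      rcases h3 i hi with h | h | h
      · left; constructor <;> linarith
      · right; right; exact ⟨h.1, by linarith [h.2]⟩
      · right; left; exact ⟨not_not.1 h.1, by linarith [h.2]⟩
    · rintro ⟨y, ⟨h1, h2, h3⟩, rfl⟩
      refine ⟨Λ.sub_mem heΛ h1, by rw [map_sub, hℓe, h2]; linarith, ?_⟩
      intro i hi
      rw [map_sub, Pi.sub_apply, hcoord i hi]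
      rcases h3 i hi with h | h | h
      · left; constructor <;> linarith
      · right; right; exact ⟨not_not.2 h.1, by linarith [h.2]⟩
      · right; left; exact ⟨h.1, by linarith [h.2]⟩
  rw [key, Set.ncard_image_of_injective _ sub_right_injective]

end ConeCoords

end HalfOpenCones

section RegularTriangulation

variable {E ι : Type*} [AddCommGroup E] [Module ℝ E]

/-- A point is generic when it lies on no proper subspace spanned by members of the family. -/
def AvoidsProperSpans (v : ι → E) (x : E) : Prop :=
  ∀ S : Finset ι, Submodule.span ℝ (v '' (S : Set ι)) ≠ ⊤ →
    x ∉ Submodule.span ℝ (v '' (S : Set ι))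

/-- The maximal cells of the regular triangulation of `posCone v` induced by the heights `ω`. -/
def regularTriangulation (v : ι → E) (ω : ι → ℝ) : Set (Finset ι) :=
  {B | LinearIndepOn ℝ v (B : Set ι) ∧ Submodule.span ℝ (v '' (B : Set ι)) = ⊤ ∧
    ∃ y : E →ₗ[ℝ] ℝ, (∀ i ∈ B, y (v i) = ω i) ∧ ∀ j ∉ B, y (v j) < ω j}

lemma card_eq_finrank_of_mem_regularTriangulation {v : ι → E} {ω : ι → ℝ} {B : Finset ι}
    (hB : B ∈ regularTriangulation v ω) : B.card = Module.finrank ℝ E := by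
  have h1 : LinearIndependent ℝ (fun i : B => v i) := hB.1
  have h2 := finrank_span_eq_card h1
  have h3 : Set.range (fun i : B => v i) = v '' (B : Set ι) := by
    rw [Set.image_eq_range]; rfl
  rw [h3, hB.2.1, finrank_top] at h2
  simpa using h2.symm

variable [Fintype ι]

/-- The convex cone generated by a finite family of vectors. -/
def posCone (v : ι → E) : Set E :=
  {x | ∃ c : ι → ℝ, (∀ i, 0 ≤ c i) ∧ ∑ i, c i • v i = x}

/-- A height function is generic when every dependent subfamily carries a linear relation
on which it does not vanish. -/
def IsGenericHeight (v : ι → E) (ω : ι → ℝ) : Prop :=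
  ∀ S : Finset ι, ¬ LinearIndepOn ℝ v (S : Set ι) →
    ∃ μ : ι → ℝ, (∀ i ∉ S, μ i = 0) ∧ ∑ i, μ i • v i = 0 ∧ ∑ i, μ i * ω i ≠ 0

lemma exists_relation_of_not_linearIndepOn {v : ι → E} {S : Finset ι}
    (h : ¬ LinearIndepOn ℝ v (S : Set ι)) :
    ∃ μ : ι → ℝ, (∀ i ∉ S, μ i = 0) ∧ ∑ i, μ i • v i = 0 ∧ μ ≠ 0 := by
  classical
  rw [linearIndepOn_finset_iff] at h
  push Not at h
  obtain ⟨f, hf, i, hi, hne⟩ := h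
  refine ⟨fun i => if i ∈ S then f i else 0, fun i hi => by simp [hi], ?_, ?_⟩
  · simpa [ite_smul, Finset.sum_ite_mem] using hf
  · intro h0
    have := congrFun h0 i
    simp [hi, hne] at this

lemma exists_isGenericHeight (v : ι → E) : ∃ ω, IsGenericHeight v ω := by
  classical
  let D := {S : Finset ι // ¬ LinearIndepOn ℝ v (S : Set ι)}
  have hrel : ∀ S : D, ∃ μ : ι → ℝ, (∀ i ∉ S.1, μ i = 0) ∧ ∑ i, μ i • v i = 0 ∧ μ ≠ 0 :=
    fun S => exists_relation_of_not_linearIndepOn S.2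
  choose μ h1 h2 h3 using hrel
  let f : D → ((ι → ℝ) →ₗ[ℝ] ℝ) := fun S => ∑ i, μ S i • LinearMap.proj i
  have hf : ∀ S ω, f S ω = ∑ i, μ S i * ω i := by
    intro S ω
    simp [f, LinearMap.sum_apply]
  have hne : ¬ (⋃ S : D, (LinearMap.ker (f S) : Set (ι → ℝ))) = Set.univ := by
    intro hcov
    obtain ⟨S, hS⟩ := Subspace.exists_eq_top_of_iUnion_eq_univ hcov
    have h0 : f S (μ S) = 0 := by
      rw [← LinearMap.mem_ker, hS]; trivial
    rw [hf] at h0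
    refine h3 S (funext fun i => ?_)
    have := (Finset.sum_eq_zero_iff_of_nonneg (fun i _ => mul_self_nonneg (μ S i))).1 h0 i
      (Finset.mem_univ i)
    simpa using this
  rw [Set.eq_univ_iff_forall] at hne
  push Not at hne
  obtain ⟨ω, hω⟩ := hne
  simp only [Set.mem_iUnion, SetLike.mem_coe, LinearMap.mem_ker, not_exists, hf] at hω
  exact ⟨ω, fun S hS => ⟨μ ⟨S, hS⟩, h1 ⟨S, hS⟩, h2 ⟨S, hS⟩, hω ⟨S, hS⟩⟩⟩

lemma exists_coneCoords {v : ι → E} {B : Finset ι} (hli : LinearIndepOn ℝ v (B : Set ι))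
    (hspan : Submodule.span ℝ (v '' (B : Set ι)) = ⊤) : Nonempty (ConeCoords v B) := by
  classical
  let b : Module.Basis B ℝ E := Module.Basis.mk (v := fun i : B => v i) hli (by
    rw [← hspan, Set.image_eq_range]; rfl)
  have hb : ∀ i : B, b i = v i := fun i =>
    Module.Basis.mk_apply (v := fun i : B => v i) hli _ i
  let φ : E →ₗ[ℝ] (ι → ℝ) := LinearMap.pi fun i => if h : i ∈ B then b.coord ⟨i, h⟩ else 0
  have hφ : ∀ x, ∀ i ∉ B, φ x i = 0 := by
    intro x i hi
    simp [φ, hi]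
  have hφB : ∀ x (i : B), φ x i = b.repr x i := by
    intro x i
    simp [φ]
  have hsumB : ∀ c : ι → ℝ, (∀ i ∉ B, c i = 0) → ∑ i, c i • v i = ∑ i : B, c i • b i := by
    intro c hc
    simp only [hb]
    rw [Finset.sum_coe_sort B (fun i => c i • v i)]
    refine (Finset.sum_subset (Finset.subset_univ B) fun i _ hi => ?_).symm
    rw [hc i hi, zero_smul]
  refine ⟨⟨φ, hφ, ?_, ?_⟩⟩
  · intro x
    rw [hsumB _ (hφ x)]
    simp only [hφB]
    exact b.sum_repr x
  · intro c hc
    funext i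
    by_cases hi : i ∈ B
    · rw [hφB _ ⟨i, hi⟩, hsumB c hc, b.repr_sum_self]
    · rw [hφ _ _ hi, hc i hi]

/-- Every generic point of the cone lies in the interior of a cell of the regular triangulation:
take the support of an optimal solution of the associated linear programme. -/
theorem exists_mem_regularTriangulation {v : ι → E} {ω : ι → ℝ} (hω : IsGenericHeight v ω)
    {ℓ : E →ₗ[ℝ] ℝ} (hℓ : ∀ i, ℓ (v i) = 1) {x : E} (hx : AvoidsProperSpans v x)
    (hxc : x ∈ posCone v) :
    ∃ B ∈ regularTriangulation v ω, ∃ c : ι → ℝ,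
      (∀ i ∈ B, 0 < c i) ∧ (∀ i ∉ B, c i = 0) ∧ ∑ i, c i • v i = x := by
  classical
  let F : Set (ι → ℝ) := {c | (∀ i, 0 ≤ c i) ∧ ∑ i, c i • v i = x}
  let Φ : (ι → ℝ) →ₗ[ℝ] E := Fintype.linearCombination ℝ v
  have hΦ : ∀ c, Φ c = ∑ i, c i • v i := fun c => by simp [Φ, Fintype.linearCombination_apply]
  have hclosed : IsClosed F := by
    have hF : F = {c | ∀ i, 0 ≤ c i} ∩ {c | Φ c = x} := by
      ext c; simp [F, hΦ]
    rw [hF]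
    refine IsClosed.inter ?_ ?_
    · simp only [Set.ofPred_forall]
      exact isClosed_iInter fun i => isClosed_le continuous_const (continuous_apply i)
    · obtain ⟨c₀, -, hc₀⟩ := hxc
      have : {c | Φ c = x} = (fun c => c - c₀) ⁻¹' (LinearMap.ker Φ : Set (ι → ℝ)) := by
        ext c
        rw [Set.mem_preimage, SetLike.mem_coe, LinearMap.mem_ker, map_sub, sub_eq_zero, hΦ c₀, hc₀]
        rfl
      rw [this]
      exact (Submodule.closed_of_finiteDimensional _).preimage (by fun_prop)
  have hbdd : F ⊆ Set.Icc (fun _ => 0) (fun _ => ℓ x) := by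
    rintro c ⟨hc0, hcx⟩
    refine ⟨fun i => hc0 i, fun i => ?_⟩
    have : ℓ x = ∑ i, c i := by rw [← hcx]; simp [map_sum, hℓ]
    rw [this]
    exact Finset.single_le_sum (fun i _ => hc0 i) (Finset.mem_univ i)
  have hcomp : IsCompact F := isCompact_Icc.of_isClosed_subset hclosed hbdd
  obtain ⟨c, ⟨hc0, hcx⟩, hmin⟩ := hcomp.exists_isMinOn (f := fun c => ∑ i, c i * ω i)
    hxc (by fun_prop)
  let S : Finset ι := Finset.univ.filter fun i => 0 < c i
  have hSmem : ∀ i, i ∈ S ↔ 0 < c i := fun i => by simp [S]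
  have hSnot : ∀ i ∉ S, c i = 0 := fun i hi =>
    le_antisymm (not_lt.1 fun h => hi ((hSmem i).2 h)) (hc0 i)
  -- moving along a relation that is nonnegative off the support cannot decrease the cost
  have hmove : ∀ μ : ι → ℝ, ∑ i, μ i • v i = 0 → (∀ i ∉ S, 0 ≤ μ i) → 0 ≤ ∑ i, μ i * ω i := by
    intro μ hμ hμS
    have hev : ∀ᶠ ε in nhdsWithin (0 : ℝ) (Set.Ioi 0), ∀ i, 0 ≤ c i + ε * μ i := by
      rw [Filter.eventually_all]
      intro i
      by_cases hi : i ∈ S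
      · have ht : Filter.Tendsto (fun ε : ℝ => c i + ε * μ i) (nhdsWithin 0 (Set.Ioi 0))
            (nhds (c i + 0 * μ i)) :=
          ((continuous_const.add (continuous_id.mul continuous_const)).tendsto
            (0 : ℝ)).mono_left nhdsWithin_le_nhds
        have : 0 < c i + 0 * μ i := by simpa using (hSmem i).1 hi
        exact (ht.eventually_const_lt this).mono fun ε h => h.le
      · filter_upwards [self_mem_nhdsWithin] with ε hε
        exact add_nonneg (hc0 i) (mul_nonneg (le_of_lt hε) (hμS i hi))
    obtain ⟨ε, hε, hpos⟩ := (hev.and self_mem_nhdsWithin).exists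
    have hmem : (fun i => c i + ε * μ i) ∈ F := by
      refine ⟨hε, ?_⟩
      simp only [add_smul, mul_smul, Finset.sum_add_distrib, ← Finset.smul_sum, hμ, hcx,
        smul_zero, add_zero]
    have := hmin hmem
    simp only [Set.mem_ofPred_eq, add_mul, Finset.sum_add_distrib, mul_assoc,
      ← Finset.mul_sum] at this
    have h2 : 0 ≤ ε * ∑ i, μ i * ω i := by linarith
    exact nonneg_of_mul_nonneg_right h2 hpos
  have hli : LinearIndepOn ℝ v (S : Set ι) := by
    by_contra hdep
    obtain ⟨μ, hμS, hμ, hne⟩ := hω S hdep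
    have h1 := hmove μ hμ fun i hi => (hμS i hi).ge
    have h2 := hmove (-μ) (by simp [hμ]) fun i hi => by simp [hμS i hi]
    simp only [Pi.neg_apply, neg_mul, Finset.sum_neg_distrib] at h2
    exact hne (by linarith)
  have hspan : Submodule.span ℝ (v '' (S : Set ι)) = ⊤ := by
    by_contra hne
    refine hx S hne ?_
    rw [← hcx]
    refine Submodule.sum_mem _ fun i _ => ?_
    by_cases hi : i ∈ S
    · exact Submodule.smul_mem _ _ (Submodule.subset_span ⟨i, hi, rfl⟩)
    · rw [hSnot i hi, zero_smul]; exact Submodule.zero_mem _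
  obtain ⟨β⟩ := exists_coneCoords hli hspan
  let y : E →ₗ[ℝ] ℝ := (∑ i, ω i • LinearMap.proj i) ∘ₗ β.coord
  have hy : ∀ z, y z = ∑ i, β.coord z i * ω i := by
    intro z
    simp [y, mul_comm]
  have hcoordv : ∀ i ∈ S, β.coord (v i) = Pi.single i 1 := by
    intro i hi
    have h1 : v i = ∑ j, (Pi.single i (1 : ℝ) : ι → ℝ) j • v j := by
      simp [Pi.single_apply, ite_smul]
    rw [h1, β.coord_sum]
    intro j hj
    rw [Pi.single_eq_of_ne]
    rintro rfl
    exact hj hi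
  have hyS : ∀ i ∈ S, y (v i) = ω i := by
    intro i hi
    rw [hy, hcoordv i hi]
    simp [Pi.single_apply]
  refine ⟨S, ⟨hli, hspan, y, hyS, ?_⟩, c, fun i hi => (hSmem i).1 hi, hSnot, hcx⟩
  intro j hj
  have hle : y (v j) ≤ ω j := by
    have := hmove (Pi.single j 1 - β.coord (v j)) (by
        simp only [Pi.sub_apply, sub_smul, Finset.sum_sub_distrib, β.sum_coord_smul]
        simp [Pi.single_apply, ite_smul]) (by
        intro i hi
        rw [Pi.sub_apply, β.coord_of_notMem _ i hi, sub_zero, Pi.single_apply]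
        split_ifs <;> norm_num)
    simp only [Pi.sub_apply, sub_mul, Finset.sum_sub_distrib, ← hy] at this
    simp only [Pi.single_apply, ite_mul, one_mul, zero_mul, Finset.sum_ite_eq',
      Finset.mem_univ, if_true] at this
    linarith
  refine lt_of_le_of_ne hle fun heq => ?_
  have hdep : ¬ LinearIndepOn ℝ v ((insert j S : Finset ι) : Set ι) := by
    rw [Finset.coe_insert]
    intro h
    have := (linearIndepOn_insert (by simpa using hj)).1 h
    exact this.2 (by rw [hspan]; trivial)
  obtain ⟨μ, hμS, hμ, hne⟩ := hω _ hdep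
  apply hne
  have h1 : ∑ i, μ i * ω i = ∑ i, μ i * y (v i) := by
    refine Finset.sum_congr rfl fun i _ => ?_
    by_cases hi : i ∈ insert j S
    · rcases Finset.mem_insert.1 hi with rfl | hi
      · rw [heq]
      · rw [hyS i hi]
    · rw [hμS i hi]; simp
  have h2 := congrArg y hμ
  simp only [map_sum, map_smul, smul_eq_mul, map_zero] at h2
  rw [h1, h2]

theorem eq_of_mem_regularTriangulation {v : ι → E} {ω : ι → ℝ} {B B' : Finset ι}
    (hB : B ∈ regularTriangulation v ω) (hB' : B' ∈ regularTriangulation v ω) {c c' : ι → ℝ}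
    (hc : ∀ i ∈ B, 0 < c i) (hc0 : ∀ i ∉ B, c i = 0)
    (hc' : ∀ i ∈ B', 0 < c' i) (hc0' : ∀ i ∉ B', c' i = 0)
    (h : ∑ i, c i • v i = ∑ i, c' i • v i) : B = B' := by
  have key : ∀ {B B' : Finset ι} {c c' : ι → ℝ}, B ∈ regularTriangulation v ω →
      (∀ i ∉ B, c i = 0) → (∀ i ∈ B', 0 < c' i) → (∀ i ∉ B', c' i = 0) →
      ∑ i, c i • v i = ∑ i, c' i • v i →
      ∑ i, c i * ω i ≤ ∑ i, c' i * ω i ∧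
        (∑ i, c' i * ω i ≤ ∑ i, c i * ω i → B' ⊆ B) := by
    intro B B' c c' hB hc0 hc' hc0' h
    obtain ⟨-, -, y, hy1, hy2⟩ := hB
    have hyle : ∀ i, y (v i) ≤ ω i := fun i => by
      by_cases hi : i ∈ B
      · exact (hy1 i hi).le
      · exact (hy2 i hi).le
    have hcpos : ∀ i, 0 ≤ c' i := fun i => by
      by_cases hi : i ∈ B'
      · exact (hc' i hi).le
      · exact (hc0' i hi).ge
    have h1 : ∑ i, c i * ω i = ∑ i, c' i * y (v i) := by
      have := congrArg y h
      simp only [map_sum, map_smul, smul_eq_mul] at this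
      rw [← this]
      refine Finset.sum_congr rfl fun i _ => ?_
      by_cases hi : i ∈ B
      · rw [hy1 i hi]
      · rw [hc0 i hi]; simp
    have hterm : ∀ i ∈ Finset.univ, c' i * y (v i) ≤ c' i * ω i := fun i _ =>
      mul_le_mul_of_nonneg_left (hyle i) (hcpos i)
    refine ⟨h1 ▸ Finset.sum_le_sum hterm, fun hle => ?_⟩
    intro i hi
    by_contra hiB
    have : ∑ i, c' i * y (v i) < ∑ i, c' i * ω i :=
      Finset.sum_lt_sum hterm ⟨i, Finset.mem_univ i,
        mul_lt_mul_of_pos_left (hy2 i hiB) (hc' i hi)⟩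
    linarith
  have k1 := key hB hc0 hc' hc0' h
  have k2 := key hB' hc0' hc hc0 h.symm
  exact Finset.Subset.antisymm (k2.2 k1.1) (k1.2 k2.1)

end RegularTriangulation

section ConeReciprocity

open Filter Topology

variable {E ι : Type*} [NormedAddCommGroup E] [NormedSpace ℝ E]

lemma AvoidsProperSpans.neg {v : ι → E} {w : E} (hw : AvoidsProperSpans v w) :
    AvoidsProperSpans v (-w) := fun S hS h => hw S hS (by simpa using h)

variable [Fintype ι]

lemma eventually_add_smul_notMem (p : Submodule ℝ E) {w : E} (hw : w ∉ p) (x : E) :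
    ∀ᶠ ε : ℝ in 𝓝[>] 0, x + ε • w ∉ p := by
  by_cases h : ∃ ε₀ : ℝ, 0 < ε₀ ∧ x + ε₀ • w ∈ p
  · obtain ⟨ε₀, hε₀, hmem⟩ := h
    filter_upwards [Ioo_mem_nhdsGT hε₀] with ε hε hmem'
    have h1 : (ε₀ - ε) • w ∈ p := by
      have := p.sub_mem hmem hmem'
      rwa [add_sub_add_left_eq_sub, ← sub_smul] at this
    exact hw ((p.smul_mem_iff (sub_pos.2 hε.2).ne').1 h1)
  · push Not at h
    filter_upwards [self_mem_nhdsWithin] with ε hε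
    exact h ε hε

lemma AvoidsProperSpans.eventually {v : ι → E} {w : E} (hw : AvoidsProperSpans v w) (x : E) :
    ∀ᶠ ε : ℝ in 𝓝[>] 0, AvoidsProperSpans v (x + ε • w) := by
  have : ∀ S : Finset ι, ∀ᶠ ε : ℝ in 𝓝[>] 0, Submodule.span ℝ (v '' (S : Set ι)) ≠ ⊤ →
      x + ε • w ∉ Submodule.span ℝ (v '' (S : Set ι)) := by
    intro S
    by_cases hS : Submodule.span ℝ (v '' (S : Set ι)) = ⊤
    · exact Eventually.of_forall fun ε h => absurd hS h
    · exact (eventually_add_smul_notMem _ (hw S hS) x).mono fun ε h _ => h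
  exact eventually_all.2 this

lemma exists_avoidsProperSpans_mem (v : ι → E) {U : Set E} (hU : IsOpen U) (hne : U.Nonempty) :
    ∃ w ∈ U, AvoidsProperSpans v w := by
  have hg : ∃ g, AvoidsProperSpans v g := by
    by_contra! hcon
    have hcov : (⋃ S : {S : Finset ι // Submodule.span ℝ (v '' (S : Set ι)) ≠ ⊤},
        (Submodule.span ℝ (v '' (S.1 : Set ι)) : Set E)) = Set.univ := by
      refine Set.eq_univ_of_forall fun x => ?_
      have := hcon x
      simp only [AvoidsProperSpans, not_forall, not_not] at this
      obtain ⟨S, hS, hx⟩ := this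
      exact Set.mem_iUnion.2 ⟨⟨S, hS⟩, hx⟩
    obtain ⟨S, hS⟩ := Subspace.exists_eq_top_of_iUnion_eq_univ hcov
    exact S.2 hS
  obtain ⟨g, hg⟩ := hg
  obtain ⟨x, hx⟩ := hne
  have ht : Tendsto (fun ε : ℝ => x + ε • g) (𝓝[>] 0) (𝓝 (x + (0 : ℝ) • g)) :=
    ((continuous_const.add (continuous_id.smul continuous_const)).tendsto
      (0 : ℝ)).mono_left nhdsWithin_le_nhds
  rw [zero_smul, add_zero] at ht
  obtain ⟨ε, h1, h2⟩ := ((hg.eventually x).and (ht (hU.mem_nhds hx))).exists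
  exact ⟨_, h2, h1⟩

lemma isClosed_posCone [FiniteDimensional ℝ E] {v : ι → E} {ℓ : E →ₗ[ℝ] ℝ} (hℓ : ∀ i, ℓ (v i) = 1) :
    IsClosed (posCone v) := by
  have hℓc : Continuous ℓ := ℓ.continuous_of_finiteDimensional
  refine isClosed_of_closure_subset fun x hx => ?_
  let K : Set E := (fun c : ι → ℝ => ∑ i, c i • v i) '' Set.Icc (fun _ => 0) (fun _ => ℓ x + 1)
  have hK : IsCompact K := isCompact_Icc.image (by fun_prop)
  have hKC : K ⊆ posCone v := by
    rintro _ ⟨c, hc, rfl⟩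
    exact ⟨c, fun i => hc.1 i, rfl⟩
  have hopen : IsOpen {y | ℓ y < ℓ x + 1} := isOpen_lt hℓc continuous_const
  have hsub : {y | ℓ y < ℓ x + 1} ∩ posCone v ⊆ K := by
    rintro y ⟨hy, c, hc, rfl⟩
    refine ⟨c, ⟨fun i => hc i, fun i => ?_⟩, rfl⟩
    have h1 : ℓ (∑ i, c i • v i) = ∑ i, c i := by simp [map_sum, hℓ]
    rw [Set.mem_ofPred_eq, h1] at hy
    exact (Finset.single_le_sum (fun i _ => hc i) (Finset.mem_univ i)).trans hy.le
  have hmem : x ∈ {y | ℓ y < ℓ x + 1} ∩ closure (posCone v) := ⟨by simp, hx⟩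
  exact hKC (hK.isClosed.closure_subset_iff.2 hsub (hopen.inter_closure hmem))

lemma ConeCoords.eventually_pos {v : ι → E} {B : Finset ι} (β : ConeCoords v B) {x w : E}
    (hx : x ∈ β.halfOpenCone fun i => 0 < β.coord w i) :
    ∀ᶠ ε : ℝ in 𝓝[>] 0, ∀ i ∈ B, 0 < β.coord (x + ε • w) i := by
  rw [eventually_all_finset]
  intro i hi
  simp only [map_add, map_smul, Pi.add_apply, Pi.smul_apply, smul_eq_mul]
  rcases hx i hi with h | ⟨h1, h2⟩
  · have ht : Tendsto (fun ε : ℝ => β.coord x i + ε * β.coord w i) (𝓝[>] 0)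
        (𝓝 (β.coord x i + 0 * β.coord w i)) :=
      ((continuous_const.add (continuous_id.mul continuous_const)).tendsto
        (0 : ℝ)).mono_left nhdsWithin_le_nhds
    exact ht.eventually_const_lt (by simpa using h)
  · filter_upwards [self_mem_nhdsWithin] with ε hε
    rw [h2, zero_add]
    exact mul_pos hε h1

lemma ConeCoords.eventually_not_pos {v : ι → E} {B : Finset ι} (β : ConeCoords v B) {x w : E}
    (hx : x ∉ β.halfOpenCone fun i => 0 < β.coord w i) :
    ∀ᶠ ε : ℝ in 𝓝[>] 0, ¬ ∀ i ∈ B, 0 < β.coord (x + ε • w) i := by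
  simp only [ConeCoords.halfOpenCone, Set.mem_ofPred_eq, not_forall, not_or, not_and] at hx
  obtain ⟨i, hi, h1, h2⟩ := hx
  suffices ∀ᶠ ε : ℝ in 𝓝[>] 0, β.coord (x + ε • w) i ≤ 0 from
    this.mono fun ε h hall => absurd (hall i hi) (not_lt.2 h)
  simp only [map_add, map_smul, Pi.add_apply, Pi.smul_apply, smul_eq_mul]
  rcases (not_lt.1 h1).lt_or_eq with h | h
  · have ht : Tendsto (fun ε : ℝ => β.coord x i + ε * β.coord w i) (𝓝[>] 0)
        (𝓝 (β.coord x i + 0 * β.coord w i)) :=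
      ((continuous_const.add (continuous_id.mul continuous_const)).tendsto
        (0 : ℝ)).mono_left nhdsWithin_le_nhds
    exact (ht.eventually_lt_const (u := 0) (by simpa using h)).mono fun ε h => h.le
  · filter_upwards [self_mem_nhdsWithin] with ε hε
    have : β.coord w i ≤ 0 := not_lt.1 fun h' => h2 h' h
    rw [h, zero_add]
    exact mul_nonpos_of_nonneg_of_nonpos (le_of_lt hε) this

/-- The points that lie in `posCone v` after an infinitesimal displacement in direction `w`. -/
def shiftedCone (v : ι → E) (w : E) : Set E :=
  {x | ∀ᶠ ε : ℝ in 𝓝[>] 0, x + ε • w ∈ posCone v}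

lemma shiftedCone_subset [FiniteDimensional ℝ E] {v : ι → E} {ℓ : E →ₗ[ℝ] ℝ} (hℓ : ∀ i, ℓ (v i) = 1) (w : E) :
    shiftedCone v w ⊆ posCone v := by
  intro x hx
  have ht : Tendsto (fun ε : ℝ => x + ε • w) (𝓝[>] 0) (𝓝 (x + (0 : ℝ) • w)) :=
    ((continuous_const.add (continuous_id.smul continuous_const)).tendsto
      (0 : ℝ)).mono_left nhdsWithin_le_nhds
  rw [zero_smul, add_zero] at ht
  exact (isClosed_posCone hℓ).mem_of_tendsto ht hx

section Decomposition

variable {v : ι → E} {ω : ι → ℝ} (β : ∀ B : regularTriangulation v ω, ConeCoords v B.1)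

lemma shiftedCone_eq_iUnion (hω : IsGenericHeight v ω) {ℓ : E →ₗ[ℝ] ℝ}
    (hℓ : ∀ i, ℓ (v i) = 1) {w : E} (hw : AvoidsProperSpans v w) :
    shiftedCone v w = ⋃ B, (β B).halfOpenCone fun i => 0 < (β B).coord w i := by
  ext x
  rw [Set.mem_iUnion]
  constructor
  · intro hx
    by_contra! hcon
    have h1 : ∀ᶠ ε : ℝ in 𝓝[>] 0, ∀ B : regularTriangulation v ω,
        ¬ ∀ i ∈ B.1, 0 < (β B).coord (x + ε • w) i :=
      eventually_all.2 fun B => (β B).eventually_not_pos (hcon B)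
    obtain ⟨ε, ⟨h1, h2⟩, h3⟩ := ((h1.and hx).and (hw.eventually x)).exists
    obtain ⟨B, hB, c, hc, hc0, hcx⟩ := exists_mem_regularTriangulation hω hℓ h3 h2
    refine h1 ⟨B, hB⟩ fun i hi => ?_
    rw [← hcx, (β ⟨B, hB⟩).coord_sum c hc0]
    exact hc i hi
  · rintro ⟨B, hB⟩
    refine ((β B).eventually_pos hB).mono fun ε hε => ?_
    refine ⟨(β B).coord (x + ε • w), fun i => ?_, (β B).sum_coord_smul _⟩
    by_cases hi : i ∈ B.1
    · exact (hε i hi).le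
    · exact ((β B).coord_of_notMem _ i hi).ge

lemma pairwise_disjoint_halfOpenCone (w : E) :
    Pairwise (Function.onFun Disjoint
      fun B => (β B).halfOpenCone fun i => 0 < (β B).coord w i) := by
  intro B B' hne
  rw [Function.onFun, Set.disjoint_left]
  intro x hx hx'
  obtain ⟨ε, h, h'⟩ := (((β B).eventually_pos hx).and ((β B').eventually_pos hx')).exists
  refine hne (Subtype.ext (eq_of_mem_regularTriangulation B.2 B'.2 h
    (fun i hi => (β B).coord_of_notMem _ i hi) h'
    (fun i hi => (β B').coord_of_notMem _ i hi) ?_))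
  rw [(β B).sum_coord_smul, (β B').sum_coord_smul]

lemma ConeCoords.coord_ne_zero {B : Finset ι} (β : ConeCoords v B)
    (hli : LinearIndepOn ℝ v (B : Set ι)) {w : E} (hw : AvoidsProperSpans v w) {i : ι}
    (hi : i ∈ B) : β.coord w i ≠ 0 := by
  classical
  intro h0
  have hvi : v i ∉ Submodule.span ℝ (v '' ((B.erase i : Finset ι) : Set ι)) := by
    rw [Finset.coe_erase]
    exact hli.notMem_span hi
  refine hw (B.erase i) (fun h => hvi (h ▸ trivial)) ?_
  rw [← β.sum_coord_smul w]
  refine Submodule.sum_mem _ fun j _ => ?_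
  by_cases hj : j ∈ B.erase i
  · exact Submodule.smul_mem _ _ (Submodule.subset_span ⟨j, hj, rfl⟩)
  · have : β.coord w j = 0 := by
      by_cases hji : j = i
      · rw [hji, h0]
      · exact β.coord_of_notMem w j fun h => hj (Finset.mem_erase.2 ⟨hji, h⟩)
    rw [this, zero_smul]
    exact Submodule.zero_mem _

end Decomposition

/-- Stanley reciprocity for a lattice cone with generators at height one, in terms of
lattice point counts: the numerator polynomials of the generating functions for the cone displaced
by `w` and by `-w` are reversals of each other. -/
theorem exists_numerators_shiftedCone [FiniteDimensional ℝ E] {v : ι → E} {Λ : AddSubgroup E} {ℓ : E →ₗ[ℝ] ℝ}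
    (hv : ∀ i, v i ∈ Λ) (hℓ : ∀ i, ℓ (v i) = 1) (hlevel : ∀ x ∈ Λ, ∃ k : ℤ, ℓ x = k)
    (hfin : ∀ k, (latticeSlice Λ ℓ (posCone v) k).Finite) {w : E} (hw : AvoidsProperSpans v w) :
    ∃ p q : ℕ → ℕ, (∀ j k, j + k = Module.finrank ℝ E → q j = p k) ∧
      (∀ j, Module.finrank ℝ E < j → p j = 0) ∧
      (∀ m, (latticeSlice Λ ℓ (shiftedCone v w) m).ncard =
        ∑ jk ∈ Finset.HasAntidiagonal.antidiagonal m,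
          p jk.1 * (Module.finrank ℝ E).multichoose jk.2) ∧
      (∀ m, (latticeSlice Λ ℓ (shiftedCone v (-w)) m).ncard =
        ∑ jk ∈ Finset.HasAntidiagonal.antidiagonal m,
          q jk.1 * (Module.finrank ℝ E).multichoose jk.2) := by
  classical
  obtain ⟨ω, hω⟩ := exists_isGenericHeight v
  let β : ∀ B : regularTriangulation v ω, ConeCoords v B.1 := fun B =>
    (exists_coneCoords B.2.1 B.2.2.1).some
  have hcard : ∀ B : regularTriangulation v ω, B.1.card = Module.finrank ℝ E := fun B =>
    card_eq_finrank_of_mem_regularTriangulation B.2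
  have : Fintype (regularTriangulation v ω) := Fintype.ofFinite _
  let num : E → ℕ → ℕ := fun u j => ∑ B, (latticeSlice Λ ℓ
    ((β B).halfOpenBox fun i => 0 < (β B).coord u i) j).ncard
  have hcount : ∀ u, AvoidsProperSpans v u → ∀ m,
      (latticeSlice Λ ℓ (shiftedCone v u) m).ncard =
        ∑ jk ∈ Finset.HasAntidiagonal.antidiagonal m,
          num u jk.1 * (Module.finrank ℝ E).multichoose jk.2 := by
    intro u hu m
    have hsub : ∀ B, (β B).halfOpenCone (fun i => 0 < (β B).coord u i) ⊆ posCone v := by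
      intro B
      refine Set.Subset.trans ?_ (shiftedCone_subset hℓ u)
      rw [shiftedCone_eq_iUnion β hω hℓ hu]
      exact Set.subset_iUnion (fun B => (β B).halfOpenCone fun i => 0 < (β B).coord u i) B
    have hfinB : ∀ B k, (latticeSlice Λ ℓ
        ((β B).halfOpenCone fun i => 0 < (β B).coord u i) k).Finite := fun B k =>
      (hfin k).subset fun x hx => ⟨hx.1, hx.2.1, hsub B hx.2.2⟩
    have hunion : latticeSlice Λ ℓ (shiftedCone v u) m =
        ⋃ B, latticeSlice Λ ℓ ((β B).halfOpenCone fun i => 0 < (β B).coord u i) m := by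
      ext x
      simp only [latticeSlice, shiftedCone_eq_iUnion β hω hℓ hu, Set.mem_ofPred_eq,
        Set.mem_iUnion]
      tauto
    rw [hunion, Set.ncard_iUnion_of_finite (fun B => hfinB B m), finsum_eq_sum_of_fintype]
    · simp_rw [num, Finset.sum_mul]
      rw [Finset.sum_comm]
      refine Finset.sum_congr rfl fun B _ => ?_
      rw [(β B).ncard_latticeSlice_halfOpenCone hv hℓ hlevel _ (hfinB B), hcard B]
    · intro B B' hne
      exact (pairwise_disjoint_halfOpenCone β u hne).mono (fun x hx => hx.2.2)
        (fun x hx => hx.2.2)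
  refine ⟨num w, num (-w), ?_, ?_, hcount w hw, hcount (-w) hw.neg⟩
  · intro j k hjk
    refine Finset.sum_congr rfl fun B _ => ?_
    rw [← (β B).ncard_latticeSlice_halfOpenBox_not hv hℓ _ (hjk.trans (hcard B).symm)]
    congr 2
    ext x
    refine forall₂_congr fun i hi => ?_
    have hne := (β B).coord_ne_zero B.2.1 hw hi
    have : (0 < (β B).coord (-w) i) = ¬ (0 < (β B).coord w i) := by
      rw [map_neg, Pi.neg_apply, neg_pos, not_lt, le_iff_lt_or_eq]
      simp [hne]
    beta_reduce
    rw [this]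
  · intro j hj
    refine Finset.sum_eq_zero fun B _ => ?_
    rw [(β B).latticeSlice_halfOpenBox_eq_empty hℓ _ (by rwa [hcard B]), Set.ncard_empty]

end ConeReciprocity

section ReflexivePolytopes

open Filter Topology

/-- The generators `(v, 1)` of the cone over the convex hull of a finite set of integer points. -/
def liftedPoint {d : ℕ} (V : Finset (Fin d → ℤ)) (i : V) : (Fin d → ℝ) × ℝ :=
  (fun j => (i.1 j : ℝ), 1)

/-- The lattice `ℤ^d × ℤ` inside `ℝ^d × ℝ`. -/
def liftedLattice (d : ℕ) : AddSubgroup ((Fin d → ℝ) × ℝ) where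
  carrier := {x | ∃ (p : Fin d → ℤ) (k : ℤ), x = (fun j => (p j : ℝ), (k : ℝ))}
  zero_mem' := ⟨0, 0, by ext <;> simp⟩
  add_mem' := by
    rintro _ _ ⟨p, k, rfl⟩ ⟨p', k', rfl⟩
    exact ⟨p + p', k + k', by ext <;> simp⟩
  neg_mem' := by
    rintro _ ⟨p, k, rfl⟩
    exact ⟨-p, -k, by ext <;> simp⟩

section PosCone

variable {E ι : Type*} [AddCommGroup E] [Module ℝ E] [Fintype ι] {v : ι → E}

lemma add_mem_posCone {x y : E} (hx : x ∈ posCone v) (hy : y ∈ posCone v) :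
    x + y ∈ posCone v := by
  obtain ⟨c, hc, rfl⟩ := hx
  obtain ⟨c', hc', rfl⟩ := hy
  exact ⟨c + c', fun i => add_nonneg (hc i) (hc' i), by
    simp [add_smul, Finset.sum_add_distrib]⟩

lemma smul_mem_posCone {t : ℝ} (ht : 0 ≤ t) {x : E} (hx : x ∈ posCone v) :
    t • x ∈ posCone v := by
  obtain ⟨c, hc, rfl⟩ := hx
  exact ⟨t • c, fun i => mul_nonneg ht (hc i), by simp [mul_smul, Finset.smul_sum]⟩

lemma mem_posCone_self (i : ι) : v i ∈ posCone v := by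
  classical
  refine ⟨Pi.single i 1, fun j => ?_, by simp [Pi.single_apply, ite_smul]⟩
  rw [Pi.single_apply]
  split_ifs <;> norm_num

lemma convex_posCone : Convex ℝ (posCone v) := fun _ hx _ hy _ _ ha hb _ =>
  add_mem_posCone (smul_mem_posCone ha hx) (smul_mem_posCone hb hy)

end PosCone

variable {d : ℕ}

/-- The real polytope spanned by a finite set of integer points. -/
def latticeHull (V : Finset (Fin d → ℤ)) : Set (Fin d → ℝ) :=
  convexHull ℝ ((fun v : Fin d → ℤ => fun i => (v i : ℝ)) '' (V : Set (Fin d → ℤ)))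

lemma mem_posCone_liftedPoint_iff {V : Finset (Fin d → ℤ)} (h0 : (0 : Fin d → ℝ) ∈ latticeHull V)
    {x : Fin d → ℝ} {t : ℝ} (ht : 0 ≤ t) :
    (x, t) ∈ posCone (liftedPoint V) ↔ x ∈ t • latticeHull V := by
  constructor
  · rintro ⟨c, hc, hcx⟩
    have h1 : ∑ i, c i = t := by
      have := congrArg Prod.snd hcx
      simpa [Prod.snd_sum, liftedPoint] using this
    have h2 : ∑ i : V, c i • (fun j => (i.1 j : ℝ)) = x := by
      have := congrArg Prod.fst hcx
      simpa [Prod.fst_sum, liftedPoint] using this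
    rcases ht.lt_or_eq with ht | ht
    · rw [Set.mem_smul_set_iff_inv_smul_mem₀ ht.ne', ← h2, Finset.smul_sum]
      simp only [smul_smul]
      refine (convex_convexHull ℝ _).sum_mem (fun i _ => mul_nonneg (inv_nonneg.2 ht.le) (hc i))
        ?_ (fun i _ => subset_convexHull ℝ _ ⟨i.1, i.2, rfl⟩)
      rw [← Finset.mul_sum, h1, inv_mul_cancel₀ ht.ne']
    · have h3 : ∀ i, c i = 0 := fun i =>
        (Finset.sum_eq_zero_iff_of_nonneg (fun i _ => hc i)).1 (h1.trans ht.symm) i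
          (Finset.mem_univ i)
      refine ⟨0, h0, ?_⟩
      simp [← h2, h3]
  · rintro ⟨y, hy, rfl⟩
    have hsub : latticeHull V ⊆ {y | (y, (1 : ℝ)) ∈ posCone (liftedPoint V)} := by
      refine convexHull_min ?_ ?_
      · rintro _ ⟨p, hp, rfl⟩
        exact mem_posCone_self (v := liftedPoint V) ⟨p, hp⟩
      · intro y hy z hz a b ha hb hab
        have := convex_posCone hy hz ha hb hab
        simpa [hab] using this
    have := smul_mem_posCone ht (hsub hy)
    simpa using this

lemma mem_interior_posCone_liftedPoint {V : Finset (Fin d → ℤ)}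
    (h0 : (0 : Fin d → ℝ) ∈ interior (latticeHull V)) :
    ((0, 1) : (Fin d → ℝ) × ℝ) ∈ interior (posCone (liftedPoint V)) := by
  rw [mem_interior_iff_mem_nhds]
  have hc : ContinuousAt (fun x : (Fin d → ℝ) × ℝ => x.2⁻¹ • x.1) (0, 1) :=
    (continuousAt_snd.inv₀ one_ne_zero).smul continuousAt_fst
  have h1 : ∀ᶠ x : (Fin d → ℝ) × ℝ in 𝓝 (0, 1), x.2⁻¹ • x.1 ∈ latticeHull V :=
    hc.eventually_mem (by simpa using mem_interior_iff_mem_nhds.1 h0)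
  have h2 : ∀ᶠ x : (Fin d → ℝ) × ℝ in 𝓝 (0, 1), 0 < x.2 :=
    continuousAt_snd.eventually_const_lt (by norm_num)
  filter_upwards [h1, h2] with x hx1 hx2
  exact (mem_posCone_liftedPoint_iff (interior_subset h0) hx2.le).2
    ((Set.mem_smul_set_iff_inv_smul_mem₀ hx2.ne' _ _).2 hx1)

/-- If all members of the dual body are at least `-t` on `x`, then `x` lies in the `t`-th dilate;
formulated for the cone over the polytope. -/
lemma mem_posCone_of_forall_dualBody {V : Finset (Fin d → ℤ)}
    (h0 : (0 : Fin d → ℝ) ∈ interior (latticeHull V)) {z : (Fin d → ℝ) × ℝ}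
    (hz : ∀ u ∈ dualBody d (latticeHull V), 0 ≤ ∑ i, u i * z.1 i + z.2) :
    z ∈ posCone (liftedPoint V) := by
  by_contra hzC
  have hℓ : ∀ i, LinearMap.snd ℝ (Fin d → ℝ) ℝ (liftedPoint V i) = 1 := fun i => rfl
  obtain ⟨f, a, hfz, hfC⟩ := geometric_hahn_banach_point_closed convex_posCone
    (isClosed_posCone hℓ) hzC
  have ha : a < 0 := by
    have := hfC 0 ⟨0, fun _ => le_rfl, by simp⟩
    simpa using this
  have hf0 : ∀ y ∈ posCone (liftedPoint V), 0 ≤ f y := by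
    intro y hy
    by_contra! hneg
    have := hfC _ (smul_mem_posCone (div_nonneg_of_nonpos ha.le hneg.le) hy)
    rw [map_smul, smul_eq_mul, div_mul_cancel₀ _ hneg.ne] at this
    exact lt_irrefl _ this
  have hc : 0 < f (0, 1) := by
    have ht : Tendsto (fun ε : ℝ => ((0, 1) : (Fin d → ℝ) × ℝ) + ε • z) (𝓝[>] 0)
        (𝓝 ((0, 1) + (0 : ℝ) • z)) :=
      ((continuous_const.add (continuous_id.smul continuous_const)).tendsto
        (0 : ℝ)).mono_left nhdsWithin_le_nhds
    rw [zero_smul, add_zero] at ht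
    obtain ⟨ε, hε, hpos⟩ := ((ht.eventually_mem (mem_interior_iff_mem_nhds.1
      (mem_interior_posCone_liftedPoint h0))).and self_mem_nhdsWithin).exists
    have := hf0 _ hε
    rw [map_add, map_smul, smul_eq_mul] at this
    have hp : (0 : ℝ) < ε := hpos
    nlinarith
  have hf : ∀ y : (Fin d → ℝ) × ℝ,
      f y = ∑ i, f (Pi.single i 1, 0) * y.1 i + y.2 * f (0, 1) := by
    intro y
    have hy : y = ∑ i, y.1 i • ((Pi.single i 1, 0) : (Fin d → ℝ) × ℝ) + y.2 • (0, 1) := by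
      ext j
      · simp [Prod.fst_sum, Pi.single_apply]
      · simp [Prod.snd_sum]
    conv_lhs => rw [hy]
    simp only [map_add, map_sum, map_smul, smul_eq_mul, mul_comm]
  set u : Fin d → ℝ := fun i => f (Pi.single i 1, 0) / f (0, 1) with hu
  have hfu : ∀ y : (Fin d → ℝ) × ℝ, ∑ i, u i * y.1 i + y.2 = f y / f (0, 1) := by
    intro y
    rw [hf y, add_div, mul_div_cancel_right₀ _ hc.ne', Finset.sum_div]
    simp only [hu, div_mul_eq_mul_div]
  have hmem : u ∈ dualBody d (latticeHull V) := by
    intro q hq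
    have h1 := hf0 (q, 1) ((mem_posCone_liftedPoint_iff (interior_subset h0) zero_le_one).2
      (by simpa using hq))
    have h2 := hfu (q, 1)
    have h3 : 0 ≤ f (q, 1) / f (0, 1) := div_nonneg h1 hc.le
    dsimp only at h2
    linarith
  have h1 := hz u hmem
  rw [hfu] at h1
  exact absurd (div_neg_of_neg_of_pos (hfz.trans ha) hc) (not_lt.2 h1)

lemma dualBody_nonneg_on_posCone {V : Finset (Fin d → ℤ)} {u : Fin d → ℝ}
    (hu : u ∈ dualBody d (latticeHull V)) {y : (Fin d → ℝ) × ℝ}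
    (hy : y ∈ posCone (liftedPoint V)) : 0 ≤ ∑ i, u i * y.1 i + y.2 := by
  obtain ⟨c, hc, rfl⟩ := hy
  have h1 : ∑ i, u i * (∑ k, c k • liftedPoint V k).1 i + (∑ k, c k • liftedPoint V k).2 =
      ∑ k, c k * (∑ i, u i * (k.1 i : ℝ) + 1) := by
    simp only [Prod.fst_sum, Prod.snd_sum, Finset.sum_apply, liftedPoint, Prod.smul_mk,
      Pi.smul_apply, smul_eq_mul, mul_one, mul_add, Finset.sum_add_distrib, Finset.mul_sum]
    rw [Finset.sum_comm]
    congr 1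
    exact Finset.sum_congr rfl fun k _ => Finset.sum_congr rfl fun i _ => by ring
  rw [h1]
  refine Finset.sum_nonneg fun k _ => mul_nonneg (hc k) ?_
  have := hu _ (subset_convexHull ℝ _ ⟨k.1, k.2, rfl⟩)
  linarith

/-- For a reflexive polytope, an infinitesimal inward displacement of the cone has the same effect
on lattice points as a displacement by the lattice vector `(0, 1)`. -/
lemma mem_shiftedCone_neg_iff {V : Finset (Fin d → ℤ)} (href : IsReflexive d (latticeHull V))
    {w : (Fin d → ℝ) × ℝ} (hw : w ∈ interior (posCone (liftedPoint V)))
    {x : (Fin d → ℝ) × ℝ} (hx : x ∈ liftedLattice d) :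
    x ∈ shiftedCone (liftedPoint V) (-w) ↔ x - (0, 1) ∈ posCone (liftedPoint V) := by
  obtain ⟨h0, U, hU⟩ := href
  have htend : ∀ a b : (Fin d → ℝ) × ℝ,
      Tendsto (fun ε : ℝ => a + ε • b) (𝓝[>] 0) (𝓝 a) := by
    intro a b
    have ht : Tendsto (fun ε : ℝ => a + ε • b) (𝓝[>] 0) (𝓝 (a + (0 : ℝ) • b)) :=
      ((continuous_const.add (continuous_id.smul continuous_const)).tendsto
        (0 : ℝ)).mono_left nhdsWithin_le_nhds
    rwa [zero_smul, add_zero] at ht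
  constructor
  · intro hxs
    change ∀ᶠ ε : ℝ in 𝓝[>] 0, x + ε • -w ∈ posCone (liftedPoint V) at hxs
    have hφw : ∀ u ∈ dualBody d (latticeHull V), 0 < ∑ i, u i * w.1 i + w.2 := by
      intro u hu
      obtain ⟨δ, hδ, hpos⟩ := (((htend w (0, -1)).eventually_mem
        (mem_interior_iff_mem_nhds.1 hw)).and self_mem_nhdsWithin).exists
      have := dualBody_nonneg_on_posCone hu hδ
      simp only [Prod.smul_mk, smul_zero, smul_eq_mul, Prod.fst_add, Prod.snd_add, add_zero]
        at this
      have hp : (0 : ℝ) < δ := hpos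
      linarith
    obtain ⟨ε, hε, hpos⟩ := (hxs.and self_mem_nhdsWithin).exists
    have hp : (0 : ℝ) < ε := hpos
    have hφx : ∀ u ∈ dualBody d (latticeHull V), 0 < ∑ i, u i * x.1 i + x.2 := by
      intro u hu
      have h1 := dualBody_nonneg_on_posCone hu hε
      have h2 : ∑ i, u i * (x + ε • -w).1 i + (x + ε • -w).2 =
          (∑ i, u i * x.1 i + x.2) - ε * (∑ i, u i * w.1 i + w.2) := by
        simp only [Prod.fst_add, Prod.snd_add, Prod.smul_fst, Prod.smul_snd, Prod.fst_neg,
          Prod.snd_neg, Pi.add_apply, Pi.smul_apply, Pi.neg_apply, smul_eq_mul, mul_add,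
          Finset.sum_add_distrib, Finset.mul_sum]
        have h3 : ∑ i, u i * (ε * -w.1 i) = -∑ i, ε * (u i * w.1 i) := by
          rw [← Finset.sum_neg_distrib]
          exact Finset.sum_congr rfl fun i _ => by ring
        rw [h3]
        ring
      have := mul_pos hp (hφw u hu)
      linarith
    obtain ⟨p, k, rfl⟩ := hx
    refine mem_posCone_of_forall_dualBody h0 fun u hu => ?_
    have hsub : dualBody d (latticeHull V) ⊆
        {u | 0 ≤ ∑ i, u i * (p i : ℝ) + ((k : ℝ) - 1)} := by
      rw [hU]
      refine convexHull_min ?_ ?_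
      · rintro _ ⟨q, hq, rfl⟩
        have h1 := hφx _ (by rw [hU]; exact subset_convexHull ℝ _ ⟨q, hq, rfl⟩)
        dsimp only at h1
        have h2 : 0 < ∑ i, q i * p i + k := by exact_mod_cast h1
        have h3 : 0 ≤ ∑ i, q i * p i + (k - 1) := by omega
        change 0 ≤ ∑ i, ((q i : ℤ) : ℝ) * (p i : ℝ) + ((k : ℝ) - 1)
        exact_mod_cast h3
      · intro y hy z hz a b ha hb hab
        have h1 := add_nonneg (mul_nonneg ha hy) (mul_nonneg hb hz)
        have h2 : ∑ i, (a • y + b • z) i * (p i : ℝ) =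
            a * ∑ i, y i * (p i : ℝ) + b * ∑ i, z i * (p i : ℝ) := by
          rw [Finset.mul_sum, Finset.mul_sum, ← Finset.sum_add_distrib]
          exact Finset.sum_congr rfl fun i _ => by
            simp only [Pi.add_apply, Pi.smul_apply, smul_eq_mul]; ring
        rw [Set.mem_ofPred_eq, h2]
        have h3 : (k : ℝ) - 1 = (a + b) * ((k : ℝ) - 1) := by rw [hab, one_mul]
        rw [h3]
        linarith
    simpa using hsub hu
  · intro hxC
    have h1 : ∀ᶠ ε : ℝ in 𝓝[>] 0, (0, 1) + ε • -w ∈ posCone (liftedPoint V) :=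
      htend (0, 1) (-w) (mem_interior_iff_mem_nhds.1 (mem_interior_posCone_liftedPoint h0))
    refine h1.mono fun ε hε => ?_
    have := add_mem_posCone hxC hε
    rwa [← add_assoc, sub_add_cancel] at this

lemma shiftedCone_eq_posCone {V : Finset (Fin d → ℤ)} {w : (Fin d → ℝ) × ℝ}
    (hw : w ∈ interior (posCone (liftedPoint V))) :
    shiftedCone (liftedPoint V) w = posCone (liftedPoint V) := by
  refine Set.Subset.antisymm
    (shiftedCone_subset (ℓ := LinearMap.snd ℝ (Fin d → ℝ) ℝ) (fun i => rfl) w) fun x hx => ?_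
  filter_upwards [self_mem_nhdsWithin] with ε hε
  exact add_mem_posCone hx (smul_mem_posCone (le_of_lt hε) (interior_subset hw))

lemma isCompact_latticeHull (V : Finset (Fin d → ℤ)) : IsCompact (latticeHull V) :=
  (V.finite_toSet.image _).isCompact_convexHull ℝ

lemma finite_latticePts {S : Set (Fin d → ℝ)} (hS : Bornology.IsBounded S) :
    (latticePts d S).Finite := by
  obtain ⟨R, hR⟩ := hS.subset_closedBall 0
  refine (Set.finite_Icc (fun _ : Fin d => -⌈R⌉) (fun _ => ⌈R⌉)).subset fun x hx => ?_
  have h1 := hR hx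
  rw [mem_closedBall_zero_iff] at h1
  have h2 : ∀ i, |(x i : ℝ)| ≤ R := fun i =>
    (norm_le_pi_norm (fun i => (x i : ℝ)) i).trans h1
  have h3 := Int.le_ceil R
  refine ⟨fun i => ?_, fun i => ?_⟩
  · have := (abs_le.1 (h2 i)).1
    have : (-⌈R⌉ : ℝ) ≤ x i := by linarith
    exact_mod_cast this
  · have := (abs_le.1 (h2 i)).2
    have : (x i : ℝ) ≤ ⌈R⌉ := by linarith
    exact_mod_cast this

lemma latticeSlice_posCone_eq_image {V : Finset (Fin d → ℤ)}
    (h0 : (0 : Fin d → ℝ) ∈ latticeHull V) (m : ℕ) :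
    latticeSlice (liftedLattice d) (LinearMap.snd ℝ (Fin d → ℝ) ℝ) (posCone (liftedPoint V)) m =
      (fun p : Fin d → ℤ => ((fun j => (p j : ℝ)), (m : ℝ))) ''
        latticePts d ((m : ℝ) • latticeHull V) := by
  ext x
  constructor
  · rintro ⟨⟨p, k, rfl⟩, h2, h3⟩
    simp only [LinearMap.snd_apply] at h2
    rw [h2] at h3 ⊢
    exact ⟨p, (mem_posCone_liftedPoint_iff h0 (Nat.cast_nonneg m)).1 h3, rfl⟩
  · rintro ⟨p, hp, rfl⟩
    exact ⟨⟨p, m, by simp⟩, rfl, (mem_posCone_liftedPoint_iff h0 (Nat.cast_nonneg m)).2 hp⟩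

lemma injective_liftAt (m : ℕ) :
    Function.Injective fun p : Fin d → ℤ => ((fun j => (p j : ℝ)), (m : ℝ)) := by
  intro p q h
  funext j
  have : (p j : ℝ) = q j := congrFun (congrArg Prod.fst h) j
  exact_mod_cast this

/-- The numerator of the Ehrhart series of a reflexive polytope together with its reversal. -/
theorem exists_ehrhart_numerators {V : Finset (Fin d → ℤ)} (href : IsReflexive d (latticeHull V)) :
    ∃ p q : ℕ → ℕ, (∀ j k, j + k = d + 1 → q j = p k) ∧ (∀ j, d + 1 < j → p j = 0) ∧ q 0 = 0 ∧
      (∀ m : ℕ, (latticePts d ((m : ℝ) • latticeHull V)).ncard =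
        ∑ jk ∈ Finset.HasAntidiagonal.antidiagonal m, p jk.1 * (d + 1).multichoose jk.2) ∧
      (∀ m : ℕ, (latticePts d ((m : ℝ) • latticeHull V)).ncard =
        ∑ jk ∈ Finset.HasAntidiagonal.antidiagonal (m + 1),
          q jk.1 * (d + 1).multichoose jk.2) := by
  have h0 := interior_subset href.1
  have hncard : ∀ m : ℕ, (latticeSlice (liftedLattice d) (LinearMap.snd ℝ (Fin d → ℝ) ℝ)
      (posCone (liftedPoint V)) m).ncard = (latticePts d ((m : ℝ) • latticeHull V)).ncard := by
    intro m
    rw [latticeSlice_posCone_eq_image h0, Set.ncard_image_of_injective _ (injective_liftAt m)]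
  have hfin : ∀ m : ℕ, (latticeSlice (liftedLattice d) (LinearMap.snd ℝ (Fin d → ℝ) ℝ)
      (posCone (liftedPoint V)) m).Finite := by
    intro m
    rw [latticeSlice_posCone_eq_image h0]
    exact (finite_latticePts ((isCompact_latticeHull V).isBounded.smul₀ _)).image _
  obtain ⟨w, hw, hgen⟩ := exists_avoidsProperSpans_mem (liftedPoint V) isOpen_interior
    ⟨_, mem_interior_posCone_liftedPoint href.1⟩
  have hrank : Module.finrank ℝ ((Fin d → ℝ) × ℝ) = d + 1 := by simp
  obtain ⟨p, q, h1, h2, h3, h4⟩ := exists_numerators_shiftedCone (v := liftedPoint V)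
    (Λ := liftedLattice d) (ℓ := LinearMap.snd ℝ (Fin d → ℝ) ℝ)
    (fun i => ⟨i.1, 1, by simp [liftedPoint]⟩) (fun i => rfl)
    (by rintro _ ⟨p, k, rfl⟩; exact ⟨k, rfl⟩) hfin hgen
  rw [hrank] at h1 h2 h3 h4
  rw [shiftedCone_eq_posCone hw] at h3
  simp only [hncard] at h3
  refine ⟨p, q, h1, h2, ?_, h3, fun m => ?_⟩
  · have h5 := h4 0
    simp only [Finset.Nat.antidiagonal_zero, Finset.sum_singleton, Nat.multichoose_zero_right,
      mul_one] at h5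
    rw [← h5]
    refine (congrArg Set.ncard (Set.eq_empty_iff_forall_notMem.2 ?_)).trans (Set.ncard_empty _)
    rintro x ⟨hx1, hx2, hx3⟩
    rw [mem_shiftedCone_neg_iff href hw hx1] at hx3
    obtain ⟨c, hc, hcx⟩ := hx3
    have h6 := congrArg Prod.snd hcx
    simp only [Prod.snd_sum, liftedPoint, Prod.smul_mk, smul_eq_mul, mul_one, Prod.snd_sub] at h6
    simp only [LinearMap.snd_apply, Nat.cast_zero] at hx2
    have := Finset.sum_nonneg fun i (_ : i ∈ Finset.univ) => hc i
    linarith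
  · rw [← h4, ← hncard]
    have himage : latticeSlice (liftedLattice d) (LinearMap.snd ℝ (Fin d → ℝ) ℝ)
        (shiftedCone (liftedPoint V) (-w)) (m + 1) =
        (fun x => x + (0, 1)) '' latticeSlice (liftedLattice d) (LinearMap.snd ℝ (Fin d → ℝ) ℝ)
          (posCone (liftedPoint V)) m := by
      have hone : ((0, 1) : (Fin d → ℝ) × ℝ) ∈ liftedLattice d := ⟨0, 1, by ext <;> simp⟩
      ext x
      constructor
      · rintro ⟨hx1, hx2, hx3⟩
        refine ⟨x - (0, 1), ⟨AddSubgroup.sub_mem _ hx1 hone, ?_,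
          (mem_shiftedCone_neg_iff href hw hx1).1 hx3⟩, by simp⟩
        rw [map_sub, hx2]
        simp
      · rintro ⟨y, ⟨hy1, hy2, hy3⟩, rfl⟩
        have hyΛ := AddSubgroup.add_mem _ hy1 hone
        refine ⟨hyΛ, ?_, (mem_shiftedCone_neg_iff href hw hyΛ).2 (by simpa using hy3)⟩
        rw [map_add, hy2]
        simp
    rw [himage, Set.ncard_image_of_injective _ (add_left_injective _)]

end ReflexivePolytopes

section EhrhartDimensionFive

open Filter Topology

lemma cast_multichoose_six (k : ℕ) :
    (Nat.multichoose 6 k : ℚ) = (k + 1) * (k + 2) * (k + 3) * (k + 4) * (k + 5) / 120 := by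
  have h := Nat.ascFactorial_eq_factorial_mul_choose k 5
  have h1 : Nat.multichoose 6 k = (k + 5).choose 5 := by
    rw [Nat.multichoose_eq, show 6 + k - 1 = k + 5 by omega, Nat.choose_symm_add]
  rw [h1]
  simp only [Nat.ascFactorial_succ, Nat.ascFactorial_zero, Nat.factorial] at h
  have h2 := congrArg (Nat.cast : ℕ → ℚ) h
  push_cast at h2
  linarith

lemma latticePts_zero_smul {d : ℕ} {S : Set (Fin d → ℝ)} (hS : S.Nonempty) :
    latticePts d (((0 : ℕ) : ℝ) • S) = {0} := by
  rw [Nat.cast_zero, Set.zero_smul_set hS]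
  ext x
  simp [latticePts, funext_iff]

/-- The point counts of a reflexive polytope of dimension five, whose numerator `(1, a, b, b, a, 1)`
is palindromic, are values of a polynomial in `(m + 1/2)²` times `m + 1/2`. -/
theorem exists_ncard_latticePts_eq {V : Finset (Fin 5 → ℤ)}
    (href : IsReflexive 5 (latticeHull V)) :
    ∃ a b : ℕ, (latticePts 5 (latticeHull V)).ncard = 6 + a ∧
      ∀ k : ℕ, ((latticePts 5 (((k + 5 : ℕ) : ℝ) • latticeHull V)).ncard : ℚ) =
        (((k + 5 : ℕ) : ℚ) + 1 / 2) *
          ((1 + a + b) / 60 * (((k + 5 : ℕ) : ℚ) ^ 2 + (k + 5 : ℕ)) ^ 2 +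
            ((a + 3) / 3 - (1 + a + b) / 30) * (((k + 5 : ℕ) : ℚ) ^ 2 + (k + 5 : ℕ)) + 2) := by
  obtain ⟨p, q, hpq, hp, hq0, hcount, hcount'⟩ := exists_ehrhart_numerators href
  have hp0 : p 0 = 1 := by
    have h := hcount 0
    rw [latticePts_zero_smul ⟨0, interior_subset href.1⟩] at h
    simpa using h.symm
  have h6 : p 6 = 0 := by rw [← hpq 0 6 rfl, hq0]
  have hcompare := fun m => (hcount m).symm.trans (hcount' m)
  have h5 : p 5 = 1 := by
    have h := hcompare 0
    simp [Finset.Nat.antidiagonal_succ, hq0, hp0, hpq 1 5 rfl] at h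
    omega
  have h4 : p 4 = p 1 := by
    have h := hcompare 1
    simp [Finset.Nat.antidiagonal_succ, hq0, hp0, hpq 1 5 rfl, hpq 2 4 rfl, h5] at h
    omega
  have h3 : p 3 = p 2 := by
    have h := hcompare 2
    simp [Finset.Nat.antidiagonal_succ, hq0, hp0, hpq 1 5 rfl, hpq 2 4 rfl, hpq 3 3 rfl, h5,
      h4] at h
    omega
  refine ⟨p 1, p 2, ?_, fun k => ?_⟩
  · have h := hcount 1
    simpa [Finset.Nat.antidiagonal_succ, hp0] using h
  · have hsum : ∑ j ∈ Finset.range (k + 5 + 1), p j * Nat.multichoose 6 (k + 5 - j) =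
        ∑ j ∈ Finset.range 6, p j * Nat.multichoose 6 (k + 5 - j) := by
      refine (Finset.sum_subset (Finset.range_mono (by omega)) fun j _ hj => ?_).symm
      rw [Finset.mem_range] at hj
      obtain rfl | hj : j = 6 ∨ 6 < j := by omega
      · rw [h6, zero_mul]
      · rw [hp j hj, zero_mul]
    have hs : ∀ j, j ≤ 5 → k + 5 - j = k + (5 - j) := fun j hj => by omega
    rw [hcount, Finset.Nat.sum_antidiagonal_eq_sum_range_succ_mk, hsum]
    simp only [Finset.sum_range_succ, Finset.sum_range_zero, hp0, h5, h4, h3]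
    rw [hs 0 (by omega), hs 1 (by omega), hs 2 (by omega), hs 3 (by omega), hs 4 (by omega),
      hs 5 (by omega)]
    push_cast [cast_multichoose_six]
    ring

/-- The Ehrhart polynomial of a five-dimensional reflexive polytope. -/
theorem exists_ehrhart_eq {V : Finset (Fin 5 → ℤ)} (href : IsReflexive 5 (latticeHull V))
    {L : ℚ[X]} (hL : IsEhrhart 5 (latticeHull V) L) :
    ∃ a b : ℕ, (latticePts 5 (latticeHull V)).ncard = 6 + a ∧
      L = (X + C (1 / 2 : ℚ)) * (C ((1 + a + b) / 60 : ℚ) * (X ^ 2 + X) ^ 2 +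
        C ((a + 3) / 3 - (1 + a + b) / 30 : ℚ) * (X ^ 2 + X) + 2) := by
  obtain ⟨a, b, h1, h2⟩ := exists_ncard_latticePts_eq href
  refine ⟨a, b, h1, Polynomial.eq_of_infinite_eval_eq _ _ ?_⟩
  refine (Set.infinite_range_of_injective (f := fun k : ℕ => ((k + 5 : ℕ) : ℚ)) ?_).mono ?_
  · intro k l h
    simpa using h
  · rintro _ ⟨k, rfl⟩
    rw [Set.mem_ofPred_eq, hL, h2]
    simp

/-- Lattice point counts of dilates recover the volume of a compact convex set. -/
lemma tendsto_ncard_latticePts_div_pow {d : ℕ} {S : Set (Fin d → ℝ)} (hS : IsCompact S)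
    (hconv : Convex ℝ S) :
    Tendsto (fun m : ℕ => ((latticePts d ((m : ℝ) • S)).ncard : ℝ) / (m : ℝ) ^ d) atTop
      (𝓝 (vol d S)) := by
  have h := tendsto_card_div_pow_atTop_volume S hS.isBounded hS.measurableSet
    (hconv.addHaar_frontier volume)
  rw [Fintype.card_fin] at h
  refine h.congr' ?_
  filter_upwards [eventually_gt_atTop 0] with m hm
  have hm0 : (m : ℝ) ≠ 0 := by positivity
  congr 2
  rw [Nat.card_coe_set_eq]
  symm
  refine Set.ncard_congr (fun x _ => (m : ℝ)⁻¹ • (fun i => (x i : ℝ))) ?_ ?_ ?_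
  · intro x hx
    refine ⟨(Set.mem_smul_set_iff_inv_smul_mem₀ hm0 _ _).1 hx, Set.smul_mem_smul_set ?_⟩
    rw [SetLike.mem_coe, Module.Basis.mem_span_iff_repr_mem]
    intro i
    simp
  · intro x y _ _ h
    have := smul_right_injective _ (inv_ne_zero hm0) h
    funext i
    have hi := congrFun this i
    simpa using hi
  · rintro y ⟨hyS, z, hz, rfl⟩
    rw [SetLike.mem_coe, Module.Basis.mem_span_iff_repr_mem] at hz
    have hz' : ∀ i, ∃ k : ℤ, (k : ℝ) = z i := fun i => by
      obtain ⟨k, hk⟩ := hz i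
      exact ⟨k, by simpa using hk⟩
    choose x hx using hz'
    have hxz : (fun i => (x i : ℝ)) = z := funext hx
    refine ⟨x, ?_, by rw [hxz]⟩
    change (fun i => (x i : ℝ)) ∈ (m : ℝ) • S
    rw [hxz]
    exact (Set.mem_smul_set_iff_inv_smul_mem₀ hm0 _ _).2 hyS

/-- A full-dimensional lattice polytope with the origin in its interior has at least `d + 2`
lattice points. -/
lemma add_two_le_ncard_latticePts {d : ℕ} (hd : 0 < d) {V : Finset (Fin d → ℤ)}
    (h0 : (0 : Fin d → ℝ) ∈ interior (latticeHull V)) :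
    d + 2 ≤ (latticePts d (latticeHull V)).ncard := by
  classical
  set U := V.erase 0 with hU
  have hsub : (insert 0 U : Finset (Fin d → ℤ)) ≤ ((latticePts d (latticeHull V)) : Set _) := by
    intro x hx
    rw [Finset.mem_coe, Finset.mem_insert] at hx
    rcases hx with rfl | hx
    · simpa [latticePts, Pi.zero_def] using interior_subset h0
    · exact subset_convexHull ℝ _ ⟨x, Finset.mem_of_mem_erase hx, rfl⟩
  have hcard := Set.ncard_le_ncard hsub (finite_latticePts (isCompact_latticeHull V).isBounded)
  rw [Set.ncard_coe_finset, Finset.card_insert_of_notMem (by simp [hU])] at hcard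
  suffices hlt : ¬ U.card ≤ d by omega
  intro hle
  let T : (Fin d → ℝ) →ₗ[ℝ] (U → ℝ) :=
    Matrix.mulVecLin (Matrix.of fun (u : U) (i : Fin d) => (u.1 i : ℝ))
  have hex : ∃ f : Fin d → ℝ, f ≠ 0 ∧ ∀ u, T f u ≤ 0 := by
    by_cases hinj : Function.Injective T
    · have hfr : Module.finrank ℝ (Fin d → ℝ) = Module.finrank ℝ (U → ℝ) := by
        refine le_antisymm (LinearMap.finrank_le_finrank_of_injective hinj) ?_
        simpa using hle
      obtain ⟨f, hf⟩ := (LinearMap.injective_iff_surjective_of_finrank_eq_finrank hfr).1 hinj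
        fun _ => -1
      refine ⟨f, ?_, fun u => by rw [hf]; norm_num⟩
      rintro rfl
      have hUd : Fintype.card U = d := by simpa using hfr.symm
      obtain ⟨u⟩ : Nonempty U := Fintype.card_pos_iff.1 (hUd.symm ▸ hd)
      have := congrFun hf u
      simp at this
    · rw [← LinearMap.ker_eq_bot, ← ne_eq, Submodule.ne_bot_iff] at hinj
      obtain ⟨f, hf, hne⟩ := hinj
      exact ⟨f, hne, fun u => by rw [LinearMap.mem_ker.1 hf]; simp⟩
  obtain ⟨f, hne, hf⟩ := hex
  have hP : latticeHull V ⊆ {x | ∑ i, x i * f i ≤ 0} := by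
    refine convexHull_min ?_ ?_
    · rintro _ ⟨x, hx, rfl⟩
      by_cases hx0 : x = 0
      · simp [hx0]
      · exact hf ⟨x, Finset.mem_erase.2 ⟨hx0, hx⟩⟩
    · refine convex_halfSpace_le (f := fun x : Fin d → ℝ => ∑ i, x i * f i) ⟨?_, ?_⟩ 0
      · intro x y
        simp [add_mul, Finset.sum_add_distrib]
      · intro c x
        simp [Finset.mul_sum, mul_assoc]
  have ht : Tendsto (fun ε : ℝ => ε • f) (𝓝[>] 0) (𝓝 0) := by
    have : Tendsto (fun ε : ℝ => ε • f) (𝓝 0) (𝓝 ((0 : ℝ) • f)) :=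
      (continuous_id.smul continuous_const).tendsto 0
    rw [zero_smul] at this
    exact this.mono_left nhdsWithin_le_nhds
  obtain ⟨ε, hε, hpos⟩ := ((ht.eventually_mem (mem_interior_iff_mem_nhds.1 h0)).and
    self_mem_nhdsWithin).exists
  have h1 : ∑ i, (ε • f) i * f i ≤ 0 := hP hε
  obtain ⟨j, hj⟩ := Function.ne_iff.1 hne
  have h2 : 0 < ∑ i, (ε • f) i * f i := by
    refine Finset.sum_pos' (fun i _ => ?_) ⟨j, Finset.mem_univ j, ?_⟩
    · simp only [Pi.smul_apply, smul_eq_mul, mul_assoc]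
      exact mul_nonneg (le_of_lt hpos) (mul_self_nonneg _)
    · simp only [Pi.smul_apply, smul_eq_mul, mul_assoc]
      exact mul_pos hpos (mul_self_pos.2 hj)
  linarith

/-- If all roots of `A (t² + t)² + B (t² + t) + 2` are real, then both roots of `A x² + B x + 2`
are real and at least `-1/4`. -/
lemma discrim_nonneg_and_le_of_real_roots {A B : ℝ} (hA : 0 < A)
    (h : ∀ t : ℂ, A * (t ^ 2 + t) ^ 2 + B * (t ^ 2 + t) + 2 = 0 → t.im = 0) :
    8 * A ≤ B ^ 2 ∧ B ≤ A / 2 := by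
  have hAC : (A : ℂ) ≠ 0 := by exact_mod_cast hA.ne'
  have key : ∀ s : ℂ, s ^ 2 = B ^ 2 - 8 * A → s.im = 0 ∧ B - A / 2 ≤ s.re := by
    intro s hs
    obtain ⟨u, hu⟩ := IsAlgClosed.exists_pow_nat_eq ((-B + s) / (2 * A) + 1 / 4 : ℂ) two_pos
    have hx : (u - 1 / 2) ^ 2 + (u - 1 / 2) = (-B + s) / (2 * A) := by
      linear_combination hu
    have him : u.im = 0 := by
      have := h (u - 1 / 2) (by
        rw [hx]
        field_simp
        linear_combination hs)
      simpa using this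
    have hre : u = (u.re : ℂ) := by
      apply Complex.ext <;> simp [him]
    have hsr : s = ((2 * A * (u.re ^ 2 - 1 / 4) + B : ℝ) : ℂ) := by
      push_cast
      rw [← hre, hu]
      field_simp
      ring
    rw [hsr, Complex.ofReal_im, Complex.ofReal_re]
    refine ⟨rfl, ?_⟩
    nlinarith [mul_nonneg hA.le (sq_nonneg u.re)]
  obtain ⟨s, hs⟩ := IsAlgClosed.exists_pow_nat_eq ((B : ℂ) ^ 2 - 8 * A) two_pos
  obtain ⟨h1, h2⟩ := key s hs
  obtain ⟨-, h3⟩ := key (-s) (by rw [neg_sq, hs])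
  rw [Complex.neg_re] at h3
  refine ⟨?_, by linarith⟩
  have hre : s = (s.re : ℂ) := by
    apply Complex.ext <;> simp [h1]
  rw [hre] at hs
  have : s.re ^ 2 = B ^ 2 - 8 * A := by exact_mod_cast hs
  nlinarith [sq_nonneg s.re]

lemma le_of_discrim_nonneg {a b : ℕ} (ha : 1 ≤ a)
    (h1 : 8 * ((1 + a + b) / 60 : ℝ) ≤ ((a + 3) / 3 - (1 + a + b) / 30 : ℝ) ^ 2)
    (h2 : ((a + 3) / 3 - (1 + a + b) / 30 : ℝ) ≤ (1 + a + b) / 60 / 2) :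
    16 / 5 ≤ ((1 + a + b) / 60 : ℝ) := by
  by_contra! hlt
  have hle : 1 + a + b ≤ 191 := by
    have : (1 + a + b : ℝ) < 192 := by linarith
    have : 1 + a + b < 192 := by exact_mod_cast this
    omega
  have hle' : ((1 + a + b) / 60 : ℝ) ≤ 191 / 60 := by
    have : ((1 + a + b : ℕ) : ℝ) ≤ 191 := by exact_mod_cast hle
    push_cast at this
    linarith
  have ha' : (1 : ℝ) ≤ a := by exact_mod_cast ha
  have hb : (0 : ℝ) ≤ b := Nat.cast_nonneg b
  obtain ⟨A, hA⟩ : ∃ A : ℝ, A = (1 + a + b) / 60 := ⟨_, rfl⟩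
  obtain ⟨B, hB⟩ : ∃ B : ℝ, B = (a + 3) / 3 - (1 + a + b) / 30 := ⟨_, rfl⟩
  rw [← hA] at h1 h2 hle'
  rw [← hB] at h1 h2
  have hA0 : 0 < A := by rw [hA]; positivity
  have hBA : 4 / 3 - 2 * A ≤ B := by rw [hA, hB]; linarith
  rcases le_total 0 B with hB0 | hB0
  · nlinarith
  · nlinarith

lemma vol_eq_of_ehrhart {V : Finset (Fin 5 → ℤ)} {L : ℚ[X]}
    (hL : IsEhrhart 5 (latticeHull V) L) {A B : ℚ}
    (h : L = (X + C (1 / 2 : ℚ)) * (C A * (X ^ 2 + X) ^ 2 + C B * (X ^ 2 + X) + 2)) :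
    vol 5 (latticeHull V) = A := by
  refine tendsto_nhds_unique (tendsto_ncard_latticePts_div_pow (isCompact_latticeHull V)
    (convex_convexHull ℝ _)) ?_
  have hinv : Tendsto (fun m : ℕ => (m : ℝ)⁻¹) atTop (𝓝 0) := tendsto_inv_atTop_nhds_zero_nat
  have hcont : Continuous fun x : ℝ => (1 + x / 2) *
      (A * (1 + x) ^ 2 + B * (x ^ 2 + x ^ 3) + 2 * x ^ 4) := by fun_prop
  have hlim := (hcont.tendsto 0).comp hinv
  have h0 : (1 + (0 : ℝ) / 2) * (A * (1 + 0) ^ 2 + B * (0 ^ 2 + 0 ^ 3) + 2 * 0 ^ 4) = A := by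
    ring
  rw [h0] at hlim
  refine hlim.congr' ?_
  filter_upwards [eventually_gt_atTop 0] with m hm
  have hm0 : (m : ℝ) ≠ 0 := by positivity
  have hc : ((latticePts 5 ((m : ℝ) • latticeHull V)).ncard : ℝ) =
      ((m : ℝ) + 1 / 2) * (A * ((m : ℝ) ^ 2 + m) ^ 2 + B * ((m : ℝ) ^ 2 + m) + 2) := by
    have h1 := hL m
    rw [h] at h1
    have h2 := congrArg (Rat.cast : ℚ → ℝ) h1
    simp only [eval_mul, eval_add, eval_X, eval_C, eval_pow, eval_ofNat] at h2
    push_cast at h2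
    exact h2.symm
  rw [hc, Function.comp_apply]
  field_simp

end EhrhartDimensionFive

theorem statement14 (P : Set (Fin 5 → ℝ)) (L : Polynomial ℚ)
    (hP : IsLatticePolytope 5 P) (hdim : IsFullDim 5 P) (href : IsReflexive 5 P)
    (hL : IsEhrhart 5 P L) (hreal : IsRealRooted L) :
    16/5 ≤ vol 5 P := by
  obtain ⟨V, rfl⟩ := hP
  change IsReflexive 5 (latticeHull V) at href
  change IsEhrhart 5 (latticeHull V) L at hL
  change 16/5 ≤ vol 5 (latticeHull V)
  obtain ⟨a, b, hcard, hLeq⟩ := exists_ehrhart_eq href hL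
  have ha : 1 ≤ a := by
    have := add_two_le_ncard_latticePts (by norm_num) href.1
    omega
  have hApos : (0 : ℝ) < (1 + a + b) / 60 := by positivity
  have hL0 : L.map (algebraMap ℚ ℂ) ≠ 0 := by
    rw [Polynomial.map_ne_zero_iff (algebraMap ℚ ℂ).injective]
    rintro rfl
    have := hL 1
    rw [eval_zero, Nat.cast_one, one_smul, hcard] at this
    norm_cast at this
    omega
  obtain ⟨h1, h2⟩ := discrim_nonneg_and_le_of_real_roots
    (B := (a + 3) / 3 - (1 + a + b) / 30) hApos fun t ht => by
      refine hreal t ((mem_roots hL0).2 ?_)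
      rw [IsRoot.def, eval_map_algebraMap, hLeq]
      simp only [map_mul, map_add, map_pow, aeval_X, aeval_C]
      push_cast at ht
      refine mul_eq_zero_of_right _ ?_
      simpa [map_ofNat] using ht
  rw [vol_eq_of_ehrhart hL hLeq]
  have := le_of_discrim_nonneg ha h1 h2
  push_cast
  exact this
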